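/- arXiv:2211.05406 — 9 statements merged into one kernel-verified Lean document; each statement's English description precedes it below -/
import Mathlib

section
/- Let k be a field of characteristic zero, g a finite-dimensional Lie algebra over k, and m an element of the universal enveloping algebra U(g). If for every x ∈ g the element ι(x)m − mι(x) lies in the image ι(g), then there exists y ∈ g such that ι(x)m − mι(x) = ι(x)ι(y) − ι(y)ι(x) for all x ∈ g. -/
namespace UniversalEnvelopingAlgebra

open TensorProduct

attribute [local instance] LieRing.ofAssociativeRing

/-- In the expansion of `(x + t y) ^ n` in powers of a central `t`, the linear coefficient is
`∑ x ^ i * y * x ^ (n - 1 - i)`. -/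
lemma exists_add_smul_pow_eq_sum {k A : Type*} [CommRing k] [Ring A] [Algebra k A]
    (x y : A) (n : ℕ) :
    ∃ c : ℕ → A, c 0 = x ^ n ∧ c 1 = ∑ i ∈ Finset.range n, x ^ i * y * x ^ (n - 1 - i) ∧
      ∀ t : k, (x + t • y) ^ n = ∑ i ∈ Finset.range (n + 1), t ^ i • c i := by
  suffices ∃ c : ℕ → A, c 0 = x ^ n ∧
      c 1 = ∑ i ∈ Finset.range n, x ^ i * y * x ^ (n - 1 - i) ∧ (∀ i, n < i → c i = 0) ∧
      ∀ t : k, (x + t • y) ^ n = ∑ i ∈ Finset.range (n + 1), t ^ i • c i by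
    obtain ⟨c, h0, h1, -, h⟩ := this
    exact ⟨c, h0, h1, h⟩
  induction n with
  | zero =>
    refine ⟨fun i => if i = 0 then 1 else 0, by simp, by simp, fun i hi => ?_, by simp⟩
    simp [hi.ne']
  | succ n ih =>
    obtain ⟨c, h0, h1, hz, h⟩ := ih
    refine ⟨fun i => x * c i + if i = 0 then 0 else y * c (i - 1), by simp [h0, pow_succ'], ?_,
      fun i hi => ?_, fun t => ?_⟩
    · rw [Finset.sum_range_succ']
      simp only [h0, h1, Finset.mul_sum]
      congr 1
      · refine Finset.sum_congr rfl fun i hi => ?_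
        rw [show n + 1 - 1 - (i + 1) = n - 1 - i by omega, pow_succ']
        simp only [mul_assoc]
      · simp
    · simp [hz i (by omega), hz (i - 1) (by omega)]
    · rw [pow_succ', h, add_mul, Finset.mul_sum, Finset.mul_sum]
      simp only [smul_add, Finset.sum_add_distrib]
      congr 1
      · rw [Finset.sum_range_succ _ (n + 1), hz (n + 1) (by omega)]
        simp
      · rw [Finset.sum_range_succ' _ (n + 1)]
        simp [pow_succ, mul_smul]

/-- If a polynomial with vector coefficients takes values in a subspace, over an infinite field,
then its coefficients lie in that subspace. -/
lemma coeff_mem_of_forall_sum_pow_smul_mem {k V : Type*} [Field k] [Infinite k] [AddCommGroup V]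
    [Module k V] (S : Submodule k V) (c : ℕ → V) (n : ℕ)
    (h : ∀ t : k, ∑ i ∈ Finset.range n, t ^ i • c i ∈ S) {i : ℕ} (hi : i < n) : c i ∈ S := by
  by_contra hc
  obtain ⟨f, hf, hS⟩ := Submodule.exists_le_ker_of_notMem hc
  have hp : (∑ j ∈ Finset.range n, Polynomial.monomial j (f (c j))) = 0 := by
    refine Polynomial.funext fun t => ?_
    have := hS (h t)
    rw [LinearMap.mem_ker, map_sum] at this
    simpa [Polynomial.eval_finsetSum, mul_comm] using this
  apply hf
  simpa [Polynomial.finsetSum_coeff, Polynomial.coeff_monomial, hi] using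
    congrArg (fun p => Polynomial.coeff p i) hp

variable {k : Type*} [Field k] {g : Type*} [LieRing g] [LieAlgebra k g]

lemma ι_lie_eq (x y : g) : ι k ⁅x, y⁆ = ι k x * ι k y - ι k y * ι k x := by
  rw [LieHom.map_lie, LieRing.of_associative_ring_bracket]

variable (k g) in
/-- The span of the powers of elements of a Lie algebra in its enveloping algebra. -/
def powerSpan : Submodule k (UniversalEnvelopingAlgebra k g) :=
  Submodule.span k (Set.range fun p : g × ℕ => ι k p.1 ^ p.2)

lemma ι_pow_mem_powerSpan (x : g) (n : ℕ) : ι k x ^ n ∈ powerSpan k g :=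
  Submodule.subset_span ⟨(x, n), rfl⟩

lemma pow_mul_mul_pow_mem_powerSpan [CharZero k] (x y : g) (a b : ℕ) :
    ι k x ^ a * ι k y * ι k x ^ b ∈ powerSpan k g := by
  induction hn : a + b generalizing y a b with
  | zero =>
    obtain ⟨rfl, rfl⟩ : a = 0 ∧ b = 0 := by omega
    simpa using ι_pow_mem_powerSpan (k := k) y 1
  | succ n ih =>
    have step (i j : ℕ) (hij : i + j = n) :
        ι k x ^ (i + 1) * ι k y * ι k x ^ j - ι k x ^ i * ι k y * ι k x ^ (j + 1) ∈
          powerSpan k g := by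
      have := ih ⁅x, y⁆ i j hij
      rw [ι_lie_eq] at this
      convert this using 1
      rw [pow_succ, pow_succ']
      noncomm_ring
    have base (i : ℕ) (hi : i ≤ n + 1) :
        ι k x ^ i * ι k y * ι k x ^ (n + 1 - i) - ι k y * ι k x ^ (n + 1) ∈ powerSpan k g := by
      induction i with
      | zero => simp
      | succ i ihi =>
        have h1 := step i (n - i) (by omega)
        have h2 := ihi (by omega)
        rw [show n + 1 - i = n - i + 1 by omega] at h2
        rw [show n + 1 - (i + 1) = n - i by omega]
        simpa using add_mem h1 h2
    obtain ⟨c, -, hc, h⟩ := exists_add_smul_pow_eq_sum (k := k) (ι k x) (ι k y) (n + 2)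
    have hlin : c 1 ∈ powerSpan k g := by
      refine coeff_mem_of_forall_sum_pow_smul_mem _ c (n + 2 + 1) (fun t => ?_) (by omega)
      rw [← h, ← map_smul, ← map_add]
      exact ι_pow_mem_powerSpan _ _
    have hsum : ∑ i ∈ Finset.range (n + 2), (ι k x ^ i * ι k y * ι k x ^ (n + 1 - i) -
        ι k y * ι k x ^ (n + 1)) ∈ powerSpan k g :=
      Submodule.sum_mem _ fun i hi => base i (by simp at hi; omega)
    have hmul : ((n + 2 : ℕ) : k) • (ι k y * ι k x ^ (n + 1)) ∈ powerSpan k g := by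
      rw [Finset.sum_sub_distrib] at hsum
      rw [show n + 2 - 1 = n + 1 by omega] at hc
      rw [← hc] at hsum
      rw [Nat.cast_smul_eq_nsmul]
      simpa only [Finset.sum_const, Finset.card_range, sub_sub_cancel] using sub_mem hlin hsum
    have hy : ι k y * ι k x ^ (n + 1) ∈ powerSpan k g :=
      ((powerSpan k g).smul_mem_iff (Nat.cast_ne_zero.mpr (by omega))).mp hmul
    have := add_mem (base a (by omega)) hy
    rw [show n + 1 - a = b by omega] at this
    simpa using this

/-- In characteristic zero, an enveloping algebra is spanned by the powers of elements of the
Lie algebra. -/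
lemma powerSpan_eq_top [CharZero k] : powerSpan k g = ⊤ := by
  have key (a : TensorAlgebra k g) :
      ∀ s ∈ powerSpan k g, mkAlgHom k g a * s ∈ powerSpan k g := by
    induction a using TensorAlgebra.induction with
    | algebraMap r =>
      intro s hs
      rw [AlgHom.commutes, ← Algebra.smul_def]
      exact Submodule.smul_mem _ _ hs
    | ι y =>
      intro s hs
      rw [← ι_apply]
      induction hs using Submodule.span_induction with
      | mem s hs =>
        obtain ⟨⟨x, n⟩, rfl⟩ := hs
        simpa using pow_mul_mul_pow_mem_powerSpan (k := k) x y 0 n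
      | zero => simp
      | add s t _ _ hs ht => rw [mul_add]; exact add_mem hs ht
      | smul r s _ hs => rw [mul_smul_comm]; exact Submodule.smul_mem _ _ hs
    | mul a b ha hb =>
      intro s hs
      rw [map_mul, mul_assoc]
      exact ha _ (hb _ hs)
    | add a b ha hb =>
      intro s hs
      rw [map_add, add_mul]
      exact add_mem (ha _ hs) (hb _ hs)
  refine eq_top_iff.mpr fun u _ => ?_
  obtain ⟨a, rfl⟩ : ∃ a, mkAlgHom k g a = u := RingCon.mkₐ_surjective _ u
  simpa using key a 1 (by simpa using ι_pow_mem_powerSpan (k := k) (0 : g) 0)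

variable (k g) in
/-- The coproduct of an enveloping algebra, for which the Lie algebra is primitive. -/
noncomputable def coproduct : UniversalEnvelopingAlgebra k g →ₐ[k]
    UniversalEnvelopingAlgebra k g ⊗[k] UniversalEnvelopingAlgebra k g :=
  lift k
    { toFun := fun x => ι k x ⊗ₜ 1 + 1 ⊗ₜ ι k x
      map_add' := fun x y => by
        simp only [map_add, TensorProduct.add_tmul, TensorProduct.tmul_add]
        abel
      map_smul' := fun r x => by
        simp [TensorProduct.smul_tmul']
      map_lie' := fun {x y} => by
        simp only [ι_lie_eq, LieRing.of_associative_ring_bracket, add_mul, mul_add,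
          Algebra.TensorProduct.tmul_mul_tmul, one_mul, mul_one, TensorProduct.sub_tmul,
          TensorProduct.tmul_sub]
        abel }

lemma coproduct_ι (x : g) : coproduct k g (ι k x) = ι k x ⊗ₜ 1 + 1 ⊗ₜ ι k x :=
  lift_ι_apply k _ x

variable (k g) in
/-- The second Adams operation `u ↦ u₍₁₎ u₍₂₎` of an enveloping algebra. -/
noncomputable def adams : Module.End k (UniversalEnvelopingAlgebra k g) :=
  LinearMap.mul' k _ ∘ₗ (coproduct k g).toLinearMap

lemma adams_ι_pow (x : g) (n : ℕ) : adams k g (ι k x ^ n) = (2 : k) ^ n • ι k x ^ n := by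
  have hcomm : Commute (ι k x ⊗ₜ[k] (1 : UniversalEnvelopingAlgebra k g))
      ((1 : UniversalEnvelopingAlgebra k g) ⊗ₜ[k] ι k x) := by
    simp [Commute, SemiconjBy]
  have hterm : ∀ i ∈ Finset.range (n + 1), n.choose i • (ι k x ^ i * ι k x ^ (n - i)) =
      n.choose i • ι k x ^ n := by
    intro i hi
    rw [← pow_add, show i + (n - i) = n by simp at hi; omega]
  simp only [adams, LinearMap.comp_apply, AlgHom.toLinearMap_apply, map_pow, coproduct_ι,
    hcomm.add_pow, ← nsmul_eq_mul', map_sum, map_nsmul, Algebra.TensorProduct.tmul_pow, one_pow,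
    Algebra.TensorProduct.tmul_mul_tmul, one_mul, mul_one, LinearMap.mul'_apply]
  rw [Finset.sum_congr rfl hterm, ← Finset.sum_smul, Nat.sum_range_choose,
    ← Nat.cast_smul_eq_nsmul k]
  simp

lemma adams_commutator (y : g) (u : UniversalEnvelopingAlgebra k g) :
    adams k g (ι k y * u - u * ι k y) = ι k y * adams k g u - adams k g u * ι k y := by
  simp only [adams, LinearMap.comp_apply, AlgHom.toLinearMap_apply, map_sub, map_mul, coproduct_ι]
  rw [← map_sub]
  induction coproduct k g u using TensorProduct.induction_on with
  | zero => simp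
  | tmul a b =>
    simp only [add_mul, mul_add, Algebra.TensorProduct.tmul_mul_tmul, one_mul, mul_one,
      map_sub, map_add, LinearMap.mul'_apply]
    noncomm_ring
  | add s t hs ht =>
    rw [mul_add, add_mul s t, add_sub_add_comm, map_add, hs, ht, map_add]
    noncomm_ring

lemma commutator_mem_eigenspace (y : g) {u : UniversalEnvelopingAlgebra k g} {μ : k}
    (hu : u ∈ (adams k g).eigenspace μ) :
    ι k y * u - u * ι k y ∈ (adams k g).eigenspace μ := by
  rw [Module.End.mem_eigenspace_iff] at hu ⊢
  rw [adams_commutator, hu, mul_smul_comm, smul_mul_assoc, smul_sub]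

lemma ι_mem_eigenspace (x : g) : ι k x ∈ (adams k g).eigenspace 2 := by
  rw [Module.End.mem_eigenspace_iff]
  simpa using adams_ι_pow (k := k) x 1

lemma commutator_mem_iSup_eigenspace (y : g) {u : UniversalEnvelopingAlgebra k g}
    (hu : u ∈ ⨆ μ ≠ (2 : k), (adams k g).eigenspace μ) :
    ι k y * u - u * ι k y ∈ ⨆ μ ≠ (2 : k), (adams k g).eigenspace μ := by
  have hle : (⨆ μ ≠ (2 : k), (adams k g).eigenspace μ) ≤
      (⨆ μ ≠ (2 : k), (adams k g).eigenspace μ).comap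
        (LinearMap.mulLeft k (ι k y) - LinearMap.mulRight k (ι k y)) :=
    iSup₂_le fun μ hμ _ hv =>
      (le_iSup₂ (f := fun (μ : k) (_ : μ ≠ 2) => (adams k g).eigenspace μ) μ hμ)
        (commutator_mem_eigenspace y hv)
  exact hle hu

/-- In characteristic zero, an enveloping algebra is the sum of the Lie algebra and the other
eigenspaces of the Adams operation. -/
lemma range_ι_sup_iSup_eigenspace [CharZero k] :
    LinearMap.range (ι k : g →ₗ⁅k⁆ UniversalEnvelopingAlgebra k g).toLinearMap ⊔
      ⨆ μ ≠ (2 : k), (adams k g).eigenspace μ = ⊤ := by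
  rw [eq_top_iff, ← powerSpan_eq_top, powerSpan, Submodule.span_le]
  rintro _ ⟨⟨x, n⟩, rfl⟩
  by_cases hn : n = 1
  · subst hn
    exact Submodule.mem_sup_left ⟨x, by simp⟩
  · refine Submodule.mem_sup_right ?_
    have hne : (2 : k) ^ n ≠ 2 := by
      intro h
      have h' : 2 ^ n = 2 ^ 1 := by exact_mod_cast h
      exact hn (Nat.pow_right_injective le_rfl h')
    exact (le_iSup₂ (f := fun (μ : k) (_ : μ ≠ 2) => (adams k g).eigenspace μ) _ hne)
      (Module.End.mem_eigenspace_iff.mpr (adams_ι_pow x n))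

end UniversalEnvelopingAlgebra

open UniversalEnvelopingAlgebra in
/-- If `m ∈ U(g)` is such that `ι(x) * m - m * ι(x)` lies in the image of `ι` for every
`x ∈ g`, then there is a single `y ∈ g` with `ι(x) * m - m * ι(x) = ι(x)ι(y) - ι(y)ι(x)`
for all `x`. -/
theorem bracket_in_lie_of_forall {k : Type*} [Field k] [CharZero k]
    {g : Type*} [LieRing g] [LieAlgebra k g] [FiniteDimensional k g]
    (m : UniversalEnvelopingAlgebra k g)
    (h : ∀ x : g, ∃ z : g, ι k x * m - m * ι k x = ι k z) :
    ∃ y : g, ∀ x : g, ι k x * m - m * ι k x = ι k x * ι k y - ι k y * ι k x := by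
  have hm := Submodule.mem_top (R := k) (x := m)
  rw [← range_ι_sup_iSup_eigenspace, Submodule.mem_sup] at hm
  obtain ⟨_, ⟨y, rfl⟩, r, hr, rfl⟩ := hm
  refine ⟨y, fun x => ?_⟩
  obtain ⟨z, hz⟩ := h x
  simp only [LieHom.coe_toLinearMap] at hz ⊢
  have hsplit : ι k x * (ι k y + r) - (ι k y + r) * ι k x =
      (ι k x * ι k y - ι k y * ι k x) + (ι k x * r - r * ι k x) := by
    noncomm_ring
  have hmem : ι k x * r - r * ι k x ∈ (adams k g).eigenspace 2 := by
    rw [← sub_eq_of_eq_add' (hz.symm.trans hsplit)]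
    exact sub_mem (ι_mem_eigenspace z) (commutator_mem_eigenspace x (ι_mem_eigenspace y))
  have hzero : ι k x * r - r * ι k x = 0 :=
    Submodule.disjoint_def.mp ((adams k g).eigenspaces_iSupIndep 2) _ hmem
      (commutator_mem_iSup_eigenspace x hr)
  rw [hsplit, hzero, add_zero]
end

section
/- Let k be a field of characteristic zero and g a finite-dimensional Lie algebra over k. If D : g → g is a derivation of g such that the composite ι ∘ D : g → U(g) is an inner derivation into U(g), i.e. there exists m ∈ U(g) with ι(D x) = ι(x)m − mι(x) for all x ∈ g, then D is an inner derivation of g, i.e. there exists y ∈ g with D x = ⁅x, y⁆ for all x ∈ g. (Injectivity of the induced map Out(g) → Out(g, U(g)).) -/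
open scoped TensorProduct

namespace FormalVectorField

section Derivation

variable {k A g : Type*} [CommRing k] [CommRing A] [Algebra k A] [LieRing g] [LieAlgebra k g]

/-- The coefficientwise action of a derivation of `A` on `A ⊗ g`. -/
def act (g : Type*) [LieRing g] [LieAlgebra k g] (D : Derivation k A A) :
    A ⊗[k] g →ₗ[k] A ⊗[k] g :=
  (D : A →ₗ[k] A).rTensor g

@[simp]
theorem act_tmul (D : Derivation k A A) (r : A) (x : g) : act g D (r ⊗ₜ x) = D r ⊗ₜ x := rfl

theorem act_one_tmul (D : Derivation k A A) (x : g) : act g D (1 ⊗ₜ x) = 0 := by simp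

theorem act_add_left (D E : Derivation k A A) (v : A ⊗[k] g) :
    act g (D + E) v = act g D v + act g E v := by
  induction v with
  | zero => simp
  | tmul r x => simp [TensorProduct.add_tmul]
  | add v w hv hw => simp only [map_add, hv, hw]; abel

theorem act_smul_left (r : A) (D : Derivation k A A) (v : A ⊗[k] g) :
    act g (r • D) v = r • act g D v := by
  induction v with
  | zero => simp
  | tmul s x => simp [TensorProduct.smul_tmul']
  | add v w hv hw => simp only [map_add, hv, hw, smul_add]

theorem act_smul (D : Derivation k A A) (r : A) (v : A ⊗[k] g) :
    act g D (r • v) = D r • v + r • act g D v := by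
  induction v with
  | zero => simp
  | tmul s x => simp [TensorProduct.smul_tmul', ← TensorProduct.add_tmul, mul_comm, add_comm]
  | add v w hv hw => simp only [map_add, hv, hw, smul_add]; abel

theorem act_lie (D : Derivation k A A) (v w : A ⊗[k] g) :
    act g D ⁅v, w⁆ = ⁅act g D v, w⁆ + ⁅v, act g D w⁆ := by
  induction v with
  | zero => simp
  | add v v' hv hv' => simp only [map_add, add_lie, hv, hv']; abel
  | tmul r x =>
    induction w with
    | zero => simp
    | add w w' hw hw' => simp only [map_add, lie_add, hw, hw']; abel
    | tmul s y => simp [← TensorProduct.add_tmul, mul_comm, add_comm]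

theorem act_commutator (D E : Derivation k A A) (v : A ⊗[k] g) :
    act g ⁅D, E⁆ v = act g D (act g E v) - act g E (act g D v) := by
  induction v with
  | zero => simp
  | tmul r x => simp [Derivation.commutator_apply, TensorProduct.sub_tmul]
  | add v w hv hw => simp only [map_add, hv, hw]; abel

theorem derivation_sum_apply {ι : Type*} (s : Finset ι) (D : ι → Derivation k A A) (f : A) :
    (∑ i ∈ s, D i) f = ∑ i ∈ s, D i f := by
  exact map_sum ((Pi.evalAddMonoidHom (fun _ : A => A) f).comp
    (Derivation.coeFnAddMonoidHom : Derivation k A A →+ _)) D s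

end Derivation

section PowerSeries

/-- The ring of formal power series, carrying `k`-module structure only through `Algebra`. -/
def PSeries (σ k : Type*) := MvPowerSeries σ k

variable {k σ : Type*} [Field k]

noncomputable instance : CommRing (PSeries σ k) := inferInstanceAs (CommRing (MvPowerSeries σ k))

noncomputable instance : Algebra k (PSeries σ k) := inferInstanceAs (Algebra k (MvPowerSeries σ k))

namespace PSeries

/-- The coefficients of a formal power series. -/
noncomputable def coeff (d : σ →₀ ℕ) : PSeries σ k →ₗ[k] k := MvPowerSeries.coeff d

/-- The constant term of a formal power series. -/
noncomputable def constCoeff : PSeries σ k →ₐ[k] k :=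
  AlgHom.mk' (MvPowerSeries.constantCoeff (σ := σ) (R := k)) fun c x => by
    rw [smul_eq_mul]; exact MvPowerSeries.constantCoeff_smul (σ := σ) (R := k) x c

/-- The partial derivatives of a formal power series. -/
noncomputable def pderiv (i : σ) : Derivation k (PSeries σ k) (PSeries σ k) :=
  MvPowerSeries.pderiv k i

/-- The variables of the ring of formal power series. -/
noncomputable def X (i : σ) : PSeries σ k := MvPowerSeries.X i

@[ext]
theorem ext {f h : PSeries σ k} (H : ∀ d, coeff d f = coeff d h) : f = h :=
  MvPowerSeries.ext H

theorem coeff_zero (f : PSeries σ k) : coeff 0 f = constCoeff f := rfl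

theorem coeff_one_of_ne {d : σ →₀ ℕ} (hd : d ≠ 0) : coeff d (1 : PSeries σ k) = 0 := by
  classical
  exact (MvPowerSeries.coeff_one (R := k) (n := d)).trans (if_neg hd)

theorem coeff_pderiv (i : σ) (f : PSeries σ k) (d : σ →₀ ℕ) :
    coeff d (pderiv i f) = coeff (d + Finsupp.single i 1) f * (d i + 1) :=
  MvPowerSeries.coeff_pderiv ..

theorem coeff_X_mul (d : σ →₀ ℕ) (i : σ) (f : PSeries σ k) :
    coeff d (X i * f) =
      if Finsupp.single i 1 ≤ d then coeff (d - Finsupp.single i 1) f else 0 := by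
  classical
  refine (MvPowerSeries.coeff_monomial_mul (R := k) d (Finsupp.single i 1) f 1).trans ?_
  rw [one_mul]
  rfl

theorem constCoeff_X (i : σ) : constCoeff (X i : PSeries σ k) = 0 :=
  MvPowerSeries.constantCoeff_X i

theorem pderiv_X [DecidableEq σ] (i j : σ) :
    pderiv i (X j : PSeries σ k) = if i = j then 1 else 0 := by
  have h : pderiv i (X j : PSeries σ k) = Pi.single (M := fun _ => PSeries σ k) i 1 j :=
    MvPowerSeries.pderiv_X (R := k) i j
  rw [h, Pi.single_apply]
  simp only [eq_comm]

theorem isUnit_of_constCoeff {f : PSeries σ k} (hf : IsUnit (constCoeff f)) : IsUnit f :=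
  MvPowerSeries.isUnit_iff_constantCoeff.2 hf

theorem pderiv_comm (i j : σ) (f : PSeries σ k) :
    pderiv i (pderiv j f) = pderiv j (pderiv i f) := by
  classical
  ext d
  simp only [coeff_pderiv]
  rw [add_right_comm]
  by_cases h : i = j
  · subst h; ring
  · simp [h, Ne.symm h]
    ring

end PSeries

end PowerSeries

open PSeries

section Field

variable {k σ g : Type*} [Field k] [Fintype σ] [LieRing g] [LieAlgebra k g] (b : Module.Basis σ k g)

/-- The derivation of the ring of formal power series on `g` attached to a formal vector field. -/
noncomputable def der :
    PSeries σ k ⊗[k] g →ₗ[PSeries σ k]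
      Derivation k (PSeries σ k) (PSeries σ k) :=
  (b.baseChange (PSeries σ k)).constr (PSeries σ k) fun i => pderiv i

omit [Fintype σ] in
theorem der_basis (i : σ) : der b (1 ⊗ₜ b i) = pderiv i := by
  classical
  rw [← Module.Basis.baseChange_apply, der, Module.Basis.constr_basis]

omit [Fintype σ] in
theorem der_tmul (r : PSeries σ k) (x : g) : der b (r ⊗ₜ x) = r • der b (1 ⊗ₜ x) := by
  rw [← map_smul, TensorProduct.smul_tmul', smul_eq_mul, mul_one]

theorem der_one_tmul (x : g) (f : PSeries σ k) :
    der b (1 ⊗ₜ x) f = ∑ i, b.repr x i • pderiv i f := by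
  conv_lhs => rw [← b.sum_repr x]
  simp only [TensorProduct.tmul_sum, TensorProduct.tmul_smul, map_sum, derivation_sum_apply]
  refine Finset.sum_congr rfl fun i _ => ?_
  rw [← algebraMap_smul (PSeries σ k) (b.repr x i), map_smul, der_basis,
    Derivation.smul_apply, algebraMap_smul]

theorem der_one_tmul_comm (x y : g) (f : PSeries σ k) :
    der b (1 ⊗ₜ x) (der b (1 ⊗ₜ y) f) = der b (1 ⊗ₜ y) (der b (1 ⊗ₜ x) f) := by
  simp only [der_one_tmul, map_sum, Derivation.map_smul, Finset.smul_sum]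
  rw [Finset.sum_comm]
  refine Finset.sum_congr rfl fun i _ => Finset.sum_congr rfl fun j _ => ?_
  rw [pderiv_comm, smul_comm]

theorem der_commutator (V W : PSeries σ k ⊗[k] g) :
    ⁅der b V, der b W⁆ = der b (act g (der b V) W - act g (der b W) V) := by
  induction V with
  | zero => simp [act]
  | add v v' hv hv' =>
    simp only [map_add, add_lie, hv, hv', act_add_left, map_sub]; abel
  | tmul r x =>
    induction W with
    | zero => simp [act]
    | add w w' hw hw' =>
      simp only [map_add, lie_add, hw, hw', act_add_left, map_sub]; abel
    | tmul s y =>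
      ext1 f
      rw [Derivation.commutator_apply, map_sub, Derivation.sub_apply]
      simp only [act_tmul]
      rw [der_tmul b (der b (r ⊗ₜ x) s), der_tmul b (der b (s ⊗ₜ y) r), der_tmul b r,
        der_tmul b s]
      simp only [Derivation.smul_apply, Derivation.leibniz, smul_eq_mul, der_one_tmul_comm b x y]
      ring

/-- The tautological (Euler) vector field. -/
noncomputable def gen : PSeries σ k ⊗[k] g := ∑ i, X i ⊗ₜ b i

theorem act_der_gen (V : PSeries σ k ⊗[k] g) : act g (der b V) (gen b) = V := by
  classical
  induction V with
  | zero => simp [act]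
  | add v w hv hw => rw [map_add, act_add_left, hv, hw]
  | tmul r x =>
    rw [der_tmul, act_smul_left]
    simp only [gen, map_sum, act_tmul, der_one_tmul, pderiv_X, smul_ite, smul_zero]
    simp only [Finset.sum_ite_eq', Finset.mem_univ, if_true, TensorProduct.smul_tmul,
      ← TensorProduct.tmul_sum, b.sum_repr, TensorProduct.smul_tmul', smul_eq_mul, mul_one]

/-- The coefficients of a `g`-valued power series. -/
noncomputable def coeffs (g : Type*) [LieRing g] [LieAlgebra k g] (d : σ →₀ ℕ) :
    PSeries σ k ⊗[k] g →ₗ[k] g :=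
  (TensorProduct.lid k g).toLinearMap ∘ₗ (coeff d).rTensor g

omit [Fintype σ] in
@[simp]
theorem coeffs_tmul (d : σ →₀ ℕ) (r : PSeries σ k) (x : g) :
    coeffs g d (r ⊗ₜ x) = coeff d r • x := rfl

omit [Fintype σ] in
theorem repr_coeffs (d : σ →₀ ℕ) (v : PSeries σ k ⊗[k] g) (i : σ) :
    b.repr (coeffs g d v) i = coeff d ((b.baseChange (PSeries σ k)).repr v i) := by
  induction v with
  | zero => simp
  | tmul r x => simp [mul_comm]
  | add v w hv hw => simp [hv, hw]

omit [Fintype σ] in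
include b in
theorem ext_coeffs {v w : PSeries σ k ⊗[k] g} (h : ∀ d, coeffs g d v = coeffs g d w) :
    v = w := by
  apply (b.baseChange (PSeries σ k)).repr.injective
  ext i d
  rw [← repr_coeffs, ← repr_coeffs, h]

theorem coeffs_gen_lie (d : σ →₀ ℕ) (v : PSeries σ k ⊗[k] g) :
    coeffs g d ⁅gen b, v⁆ =
      ∑ i, if Finsupp.single i 1 ≤ d then ⁅b i, coeffs g (d - Finsupp.single i 1) v⁆ else 0 := by
  induction v with
  | zero => simp
  | add v w hv hw =>
    rw [lie_add, map_add, hv, hw, ← Finset.sum_add_distrib]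
    refine Finset.sum_congr rfl fun i _ => ?_
    split_ifs <;> simp
  | tmul r x =>
    simp only [gen, sum_lie]
    simp [coeff_X_mul, ite_smul]

theorem coeff_euler (d : σ →₀ ℕ) (f : PSeries σ k) :
    coeff d (der b (gen b) f) = (d.degree : k) * coeff d f := by
  have h : der b (gen b) f = ∑ i, X i * pderiv i f := by
    simp only [gen, map_sum, derivation_sum_apply]
    simp only [der_tmul b (X _), der_basis, Derivation.smul_apply, smul_eq_mul]
  rw [h, map_sum, Finsupp.degree_eq_sum, Nat.cast_sum, Finset.sum_mul]
  refine Finset.sum_congr rfl fun i _ => ?_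
  rw [coeff_X_mul]
  split_ifs with hi
  · rw [coeff_pderiv, tsub_add_cancel_of_le hi, mul_comm]
    congr 1
    have : 1 ≤ d i := by simpa using hi i
    simp [Nat.cast_sub this]
  · have : d i = 0 := by
      by_contra h0
      exact hi (by simpa [Nat.one_le_iff_ne_zero] using h0)
    simp [this]

theorem coeffs_euler (d : σ →₀ ℕ) (v : PSeries σ k ⊗[k] g) :
    coeffs g d (act g (der b (gen b)) v) = (d.degree : k) • coeffs g d v := by
  induction v with
  | zero => simp
  | add v w hv hw => rw [map_add, map_add, hv, hw, map_add, smul_add]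
  | tmul r x => simp [coeff_euler, mul_smul]


/-- The `g`-valued power series with given coefficients. -/
noncomputable def ofCoeffs (h : (σ →₀ ℕ) → g) : PSeries σ k ⊗[k] g :=
  ∑ i, (show PSeries σ k from fun d => b.repr (h d) i) ⊗ₜ b i

theorem coeffs_ofCoeffs (h : (σ →₀ ℕ) → g) (d : σ →₀ ℕ) : coeffs g d (ofCoeffs b h) = h d := by
  rw [ofCoeffs, map_sum]
  exact b.sum_repr (h d)

section CharZero

variable [CharZero k]

theorem eq_zero_of_euler_eq {c : ℕ} (hc : c ≠ 0) {v : PSeries σ k ⊗[k] g}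
    (h : act g (der b (gen b)) v + (c : k) • v = -⁅gen b, v⁆) : v = 0 := by
  refine ext_coeffs b fun d => ?_
  rw [map_zero]
  induction hn : d.degree using Nat.strong_induction_on generalizing d with
  | _ n ih =>
    have H := congrArg (coeffs g d) h
    rw [map_add, coeffs_euler, map_smul, map_neg, coeffs_gen_lie, Finset.sum_eq_zero,
      neg_zero, ← add_smul] at H
    · refine (smul_eq_zero.1 H).resolve_left ?_
      rw [← Nat.cast_add]
      exact Nat.cast_ne_zero.2 (by omega)
    · intro i _
      split_ifs with hi
      · rw [ih _ _ _ rfl, lie_zero]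
        have := congrArg Finsupp.degree (tsub_add_cancel_of_le hi)
        rw [map_add, Finsupp.degree_single] at this
        omega
      · rfl

/-- The iterates `(-ad y)ᵐ a / (m + 1)!`, where `y` is the tautological vector field. -/
noncomputable def iterTerm (a : g) : ℕ → PSeries σ k ⊗[k] g
  | 0 => 1 ⊗ₜ a
  | m + 1 => -((m + 2 : k)⁻¹ • ⁅gen b, iterTerm a m⁆)

/-- The Maurer-Cartan form `(1 - exp (-ad y)) / ad y` on constant vector fields. -/
noncomputable def mcConst (a : g) : PSeries σ k ⊗[k] g :=
  ofCoeffs b fun d => coeffs g d (iterTerm b a d.degree)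

omit [CharZero k] in
theorem coeffs_zero_mcConst (a : g) : coeffs g 0 (mcConst b a) = a := by
  rw [mcConst, coeffs_ofCoeffs, map_zero, iterTerm, coeffs_tmul, coeff_zero, map_one, one_smul]

theorem euler_mcConst (a : g) :
    act g (der b (gen b)) (mcConst b a) = 1 ⊗ₜ a - ⁅gen b, mcConst b a⁆ - mcConst b a := by
  rw [eq_sub_iff_add_eq]
  refine ext_coeffs b fun d => ?_
  rw [map_add, coeffs_euler, map_sub, coeffs_gen_lie]
  simp only [mcConst, coeffs_ofCoeffs]
  rcases hd : d.degree with _ | m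
  · rw [Finsupp.degree_eq_zero_iff] at hd
    subst hd
    simp [iterTerm, coeff_zero]
  · have hd0 : d ≠ 0 := by rintro rfl; simp at hd
    rw [coeffs_tmul, coeff_one_of_ne hd0, zero_smul, zero_sub, iterTerm, map_neg, map_smul,
      coeffs_gen_lie, smul_neg, ← neg_add, neg_inj]
    have hm : (m + 2 : k) ≠ 0 := by exact_mod_cast Nat.succ_ne_zero (m + 1)
    rw [smul_smul, ← add_smul]
    have : ((m + 1 : ℕ) : k) * (m + 2 : k)⁻¹ + (m + 2 : k)⁻¹ = 1 := by
      field_simp; push_cast; ring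
    rw [this, one_smul]
    refine Finset.sum_congr rfl fun i _ => ?_
    split_ifs with hi
    · have := congrArg Finsupp.degree (tsub_add_cancel_of_le hi)
      rw [map_add, Finsupp.degree_single] at this
      have hdm : (d - Finsupp.single i 1).degree = m := by omega
      rw [hdm]
    · rfl

theorem eq_mcConst {a : g} {v : PSeries σ k ⊗[k] g}
    (h : act g (der b (gen b)) v = 1 ⊗ₜ a - ⁅gen b, v⁆ - v) : v = mcConst b a := by
  rw [← sub_eq_zero]
  refine eq_zero_of_euler_eq b (c := 1) one_ne_zero ?_
  rw [map_sub, h, euler_mcConst, lie_sub, Nat.cast_one, one_smul]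
  abel

/-- The Maurer-Cartan form, as an endomorphism of the module of formal vector fields. -/
noncomputable def mc : PSeries σ k ⊗[k] g →ₗ[PSeries σ k] PSeries σ k ⊗[k] g :=
  LinearMap.liftBaseChange (PSeries σ k)
    { toFun := mcConst b
      map_add' := fun a c => by
        refine (eq_mcConst b ?_).symm
        rw [map_add, euler_mcConst, euler_mcConst, lie_add, TensorProduct.tmul_add]
        abel
      map_smul' := fun r a => by
        refine (eq_mcConst b ?_).symm
        rw [RingHom.id_apply, map_smul, euler_mcConst, lie_smul, TensorProduct.tmul_smul]
        simp only [smul_sub] }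

theorem mc_tmul (r : PSeries σ k) (a : g) : mc b (r ⊗ₜ a) = r • mcConst b a :=
  LinearMap.liftBaseChange_tmul ..

theorem mc_one_tmul (a : g) : mc b (1 ⊗ₜ a) = mcConst b a := by rw [mc_tmul, one_smul]

omit [CharZero k] in
theorem act_der_const_euler (a : g) (v : PSeries σ k ⊗[k] g) :
    act g (der b (gen b)) (act g (der b (1 ⊗ₜ a)) v) =
      act g (der b (1 ⊗ₜ a)) (act g (der b (gen b)) v) - act g (der b (1 ⊗ₜ a)) v := by
  have h := act_commutator (der b (1 ⊗ₜ a)) (der b (gen b)) v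
  rw [der_commutator, act_der_gen, act_one_tmul, sub_zero] at h
  exact eq_sub_of_add_eq (by rw [add_comm]; exact eq_sub_iff_add_eq.1 h)

theorem maurer_cartan_const (a c : g) :
    act g (der b (1 ⊗ₜ a)) (mcConst b c) - act g (der b (1 ⊗ₜ c)) (mcConst b a) +
      ⁅mcConst b a, mcConst b c⁆ = 0 := by
  refine eq_zero_of_euler_eq b (c := 2) two_ne_zero ?_
  simp only [map_add, map_sub, act_der_const_euler, euler_mcConst, act_lie, act_der_gen,
    act_one_tmul, lie_add, lie_sub, sub_lie]
  rw [leibniz_lie (gen b), ← lie_skew (mcConst b a) (1 ⊗ₜ c), Nat.cast_two, two_smul]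
  abel

theorem maurer_cartan (V W : PSeries σ k ⊗[k] g) :
    mc b (act g (der b V) W - act g (der b W) V) =
      act g (der b V) (mc b W) - act g (der b W) (mc b V) + ⁅mc b V, mc b W⁆ := by
  induction V with
  | zero => simp [act]
  | add v v' hv hv' =>
    rw [map_sub] at hv hv' ⊢
    simp only [map_add, act_add_left, add_lie]
    linear_combination (norm := abel) hv + hv'
  | tmul r a =>
    induction W with
    | zero => simp [act]
    | add w w' hw hw' =>
      rw [map_sub] at hw hw' ⊢
      simp only [map_add, act_add_left, lie_add]
      linear_combination (norm := abel) hw + hw'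
    | tmul s c =>
      have h := congrArg (fun v => (r * s) • v) (maurer_cartan_const b a c)
      simp only [smul_zero, smul_add, smul_sub] at h
      rw [der_tmul b r, der_tmul b s]
      simp only [act_smul_left, act_tmul, map_sub, mc_tmul, act_smul, smul_lie, lie_smul, smul_smul]
      rw [mul_comm s r]
      linear_combination (norm := abel) -h

/-- The linear vector field with coefficients `⁅x, y⁆`. -/
noncomputable def adField (x : g) : Derivation k (PSeries σ k) (PSeries σ k) :=
  der b ⁅(1 : PSeries σ k) ⊗ₜ[k] x, gen b⁆

omit [CharZero k] in
theorem act_adField_euler (x : g) (v : PSeries σ k ⊗[k] g) :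
    act g (der b (gen b)) (act g (adField b x) v) =
      act g (adField b x) (act g (der b (gen b)) v) := by
  have h := act_commutator (adField b x) (der b (gen b)) v
  rw [adField, der_commutator, act_der_gen, act_lie, act_one_tmul, zero_lie, zero_add,
    act_der_gen, sub_self, map_zero] at h
  rw [adField, eq_comm, ← sub_eq_zero, ← h]
  simpa using act_smul_left (0 : PSeries σ k) 0 v

theorem act_adField_mcConst (x c : g) :
    act g (adField b x) (mcConst b c) =
      ⁅(1 : PSeries σ k) ⊗ₜ[k] x, mcConst b c⁆ - mcConst b ⁅x, c⁆ := by
  rw [← sub_eq_zero]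
  refine eq_zero_of_euler_eq b (c := 1) one_ne_zero ?_
  simp only [map_sub, act_adField_euler, euler_mcConst, act_lie, act_one_tmul, lie_sub, zero_lie]
  rw [adField, act_der_gen, leibniz_lie (gen b), ← lie_skew (gen b) (1 ⊗ₜ x), Nat.cast_one,
    one_smul, LieAlgebra.ExtendScalars.bracket_tmul, one_mul, neg_lie]
  abel

theorem mc_adField (x : g) (W : PSeries σ k ⊗[k] g) :
    mc b (act g (adField b x) W - act g (der b W) ⁅(1 : PSeries σ k) ⊗ₜ[k] x, gen b⁆) =
      act g (adField b x) (mc b W) - ⁅(1 : PSeries σ k) ⊗ₜ[k] x, mc b W⁆ := by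
  rw [act_lie, act_one_tmul, zero_lie, zero_add, act_der_gen]
  induction W with
  | zero => simp
  | add w w' hw hw' =>
    rw [map_sub] at hw hw' ⊢
    simp only [map_add, lie_add]
    linear_combination (norm := abel) hw + hw'
  | tmul s c =>
    simp only [act_tmul, map_sub, mc_tmul, act_smul, lie_smul, act_adField_mcConst, smul_sub,
      LieAlgebra.ExtendScalars.bracket_tmul, one_mul]
    abel

omit [Fintype σ] [CharZero k] in
theorem coeffs_zero_smul (r : PSeries σ k) (v : PSeries σ k ⊗[k] g) :
    coeffs g 0 (r • v) = constCoeff r • coeffs g 0 v := by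
  induction v with
  | zero => simp
  | add v w hv hw => simp only [smul_add, map_add, hv, hw]
  | tmul s x => simp [TensorProduct.smul_tmul', coeff_zero, mul_smul]

theorem coeffs_zero_mc (v : PSeries σ k ⊗[k] g) : coeffs g 0 (mc b v) = coeffs g 0 v := by
  induction v with
  | zero => simp
  | add v w hv hw => simp only [map_add, hv, hw]
  | tmul s x => rw [mc_tmul, coeffs_zero_smul, coeffs_zero_mcConst, coeffs_tmul, coeff_zero]

theorem isUnit_det_mc : IsUnit (LinearMap.det (mc b)) := by
  classical
  apply isUnit_of_constCoeff
  rw [← LinearMap.det_toMatrix (b.baseChange (PSeries σ k)), AlgHom.map_det]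
  convert isUnit_one
  rw [← Matrix.det_one (n := σ)]
  congr 1
  ext i j
  rw [AlgHom.mapMatrix_apply, Matrix.map_apply, LinearMap.toMatrix_apply,
    Module.Basis.baseChange_apply, ← coeff_zero, ← repr_coeffs, coeffs_zero_mc, coeffs_tmul,
    coeff_zero, map_one, one_smul, b.repr_self, Matrix.one_apply, Finsupp.single_apply]
  simp only [eq_comm]

theorem mc_bijective : Function.Bijective (mc b) := by
  have := Module.Finite.of_basis (b.baseChange (PSeries σ k))
  have := Module.Free.of_basis (b.baseChange (PSeries σ k))
  rw [← LinearMap.coe_equivOfIsUnitDet (isUnit_det_mc b)]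
  exact (LinearMap.equivOfIsUnitDet (isUnit_det_mc b)).bijective

/-- The Maurer-Cartan form as a linear equivalence. -/
noncomputable def mcEquiv : (PSeries σ k ⊗[k] g) ≃ₗ[PSeries σ k] (PSeries σ k ⊗[k] g) :=
  LinearEquiv.ofBijective (mc b) (mc_bijective b)

/-- The left-invariant formal vector field with value `a` at the origin. -/
noncomputable def invField : g →ₗ[k] PSeries σ k ⊗[k] g :=
  (mcEquiv b).symm.toLinearMap.restrictScalars k ∘ₗ TensorProduct.mk k (PSeries σ k) g 1

theorem mc_invField (a : g) : mc b (invField b a) = 1 ⊗ₜ a :=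
  (mcEquiv b).apply_symm_apply (1 ⊗ₜ a)

theorem der_invField_lie (a c : g) :
    der b (invField b ⁅a, c⁆) = ⁅der b (invField b a), der b (invField b c)⁆ := by
  rw [der_commutator]
  congr 1
  apply (mc_bijective b).1
  rw [maurer_cartan, mc_invField, mc_invField, mc_invField, act_one_tmul, act_one_tmul, sub_self,
    zero_add, LieAlgebra.ExtendScalars.bracket_tmul, one_mul]

theorem adField_commutator (x a : g) :
    ⁅adField b x, der b (invField b a)⁆ = -der b (invField b ⁅x, a⁆) := by
  conv_lhs => rw [adField]
  rw [der_commutator, ← map_neg]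
  congr 1
  apply (mc_bijective b).1
  have h := mc_adField b x (invField b a)
  rw [adField] at h
  rw [h, mc_invField, map_neg, mc_invField, act_one_tmul, zero_sub,
    LieAlgebra.ExtendScalars.bracket_tmul, one_mul]

attribute [local instance] LieRing.ofAssociativeRing

/-- The representation of `g` on formal power series by left-invariant vector fields. -/
noncomputable def invRep : g →ₗ⁅k⁆ Module.End k (PSeries σ k) where
  toFun a := (der b (invField b a) : PSeries σ k →ₗ[k] PSeries σ k)
  map_add' a c := by simp only [map_add]; rfl
  map_smul' r a := by
    rw [map_smul, ← algebraMap_smul (PSeries σ k) r, map_smul]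
    ext f
    simp
  map_lie' {a c} := by
    ext1 f
    rw [der_invField_lie]
    exact Derivation.commutator_apply ..

/-- The action of the enveloping algebra on formal power series by differential operators. -/
noncomputable def diffOp :
    UniversalEnvelopingAlgebra k g →ₐ[k] Module.End k (PSeries σ k) :=
  UniversalEnvelopingAlgebra.lift k (invRep b)

theorem diffOp_ι (a : g) :
    diffOp b (UniversalEnvelopingAlgebra.ι k a) =
      (der b (invField b a) : PSeries σ k →ₗ[k] PSeries σ k) := by
  rw [diffOp, UniversalEnvelopingAlgebra.lift_ι_apply]; rfl

end CharZero
end Field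
end FormalVectorField

theorem UniversalEnvelopingAlgebra.mem_of_ι_mem {k g : Type*} [CommRing k] [LieRing g]
    [LieAlgebra k g] (S : Subalgebra k (UniversalEnvelopingAlgebra k g))
    (hS : ∀ x : g, UniversalEnvelopingAlgebra.ι k x ∈ S) (u : UniversalEnvelopingAlgebra k g) :
    u ∈ S := by
  obtain ⟨t, rfl⟩ : ∃ t, UniversalEnvelopingAlgebra.mkAlgHom k g t = u :=
    RingCon.mkₐ_surjective _ u
  induction t using TensorAlgebra.induction with
  | algebraMap r => rw [AlgHom.commutes]; exact S.algebraMap_mem r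
  | ι x => exact hS x
  | mul a c ha hc => rw [map_mul]; exact S.mul_mem ha hc
  | add a c ha hc => rw [map_add]; exact S.add_mem ha hc

namespace FormalVectorField

open PSeries

variable {k σ g : Type*} [Field k] [CharZero k] [Fintype σ] [LieRing g] [LieAlgebra k g]
  (b : Module.Basis σ k g)

theorem commute_diffOp (x : g) (u : UniversalEnvelopingAlgebra k g) :
    Commute ((adField b x : PSeries σ k →ₗ[k] PSeries σ k) +
      diffOp b (UniversalEnvelopingAlgebra.ι k x) : Module.End k (PSeries σ k)) (diffOp b u) := by
  set T : Module.End k (PSeries σ k) := (adField b x : PSeries σ k →ₗ[k] PSeries σ k) +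
    diffOp b (UniversalEnvelopingAlgebra.ι k x) with hT
  suffices h : u ∈ (Subalgebra.centralizer k {T}).comap (diffOp b) from
    Subalgebra.mem_centralizer_iff k |>.1 h T rfl
  refine UniversalEnvelopingAlgebra.mem_of_ι_mem _ (fun a => ?_) u
  rw [Subalgebra.mem_comap, Subalgebra.mem_centralizer_iff]
  intro T' hT'
  rw [Set.mem_singleton_iff.1 hT', hT, diffOp_ι, diffOp_ι]
  ext1 f
  have h₁ := congrArg (· f) (adField_commutator b x a)
  have h₂ := congrArg (· f) (der_invField_lie b x a)
  simp only [Derivation.commutator_apply, Derivation.neg_apply] at h₁ h₂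
  simp only [Module.End.mul_apply, LinearMap.add_apply, Derivation.coeFn_coe, map_add]
  rw [h₂] at h₁
  linear_combination h₁

/-- The equivariant projection of the enveloping algebra onto the Lie algebra, sending `u` to the
value at the origin of the corresponding differential operator on the coordinate functions. -/
noncomputable def proj (u : UniversalEnvelopingAlgebra k g) : g :=
  coeffs g 0 ((diffOp b u).rTensor g (gen b))

theorem proj_ι (a : g) : proj b (UniversalEnvelopingAlgebra.ι k a) = a := by
  have h : (diffOp b (UniversalEnvelopingAlgebra.ι k a)).rTensor g (gen b) =
      act g (der b (invField b a)) (gen b) := by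
    rw [act, diffOp_ι]
  rw [proj, h, act_der_gen, ← coeffs_zero_mc b, mc_invField, coeffs_tmul, coeff_zero, map_one,
    one_smul]

omit [Fintype σ] [CharZero k] in
theorem coeffs_zero_act (V v : PSeries σ k ⊗[k] g) (hV : coeffs g 0 V = 0) :
    coeffs g 0 (act g (der b V) v) = 0 := by
  have h : ∀ V : PSeries σ k ⊗[k] g, coeffs g 0 (act g (der b V) v) =
      coeffs g 0 (act g (der b (1 ⊗ₜ coeffs g 0 V)) v) := by
    intro V
    induction V with
    | zero => simp
    | add V W hV hW => simp only [map_add, act_add_left, TensorProduct.tmul_add, hV, hW]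
    | tmul r x =>
      rw [der_tmul, act_smul_left, coeffs_zero_smul, coeffs_tmul, TensorProduct.tmul_smul,
        ← algebraMap_smul (PSeries σ k) (coeff 0 r), map_smul, act_smul_left, algebraMap_smul,
        map_smul, coeff_zero]
  rw [h, hV, TensorProduct.tmul_zero, map_zero]
  exact (congrArg _ (by simpa using act_smul_left (0 : PSeries σ k) 0 v)).trans (map_zero _)

omit [Fintype σ] [CharZero k] in
theorem coeffs_zero_lie (x : g) (v : PSeries σ k ⊗[k] g) :
    coeffs g 0 ⁅(1 : PSeries σ k) ⊗ₜ[k] x, v⁆ = ⁅x, coeffs g 0 v⁆ := by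
  induction v with
  | zero => simp
  | add v w hv hw => simp only [lie_add, map_add, hv, hw]
  | tmul r y => simp

omit [Fintype σ] [CharZero k] in
theorem rTensor_lie (T : Module.End k (PSeries σ k)) (x : g) (v : PSeries σ k ⊗[k] g) :
    T.rTensor g ⁅(1 : PSeries σ k) ⊗ₜ[k] x, v⁆ = ⁅(1 : PSeries σ k) ⊗ₜ[k] x, T.rTensor g v⁆ := by
  induction v with
  | zero => simp
  | add v w hv hw => simp only [lie_add, map_add, hv, hw]
  | tmul r y => simp

omit [CharZero k] in
theorem coeffs_zero_gen : coeffs g 0 (gen b) = 0 := by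
  simp [gen, coeff_zero, constCoeff_X]

theorem proj_commutator (x : g) (u : UniversalEnvelopingAlgebra k g) :
    proj b (UniversalEnvelopingAlgebra.ι k x * u - u * UniversalEnvelopingAlgebra.ι k x) =
      ⁅x, proj b u⁆ := by
  set A : Module.End k (PSeries σ k) := (adField b x : PSeries σ k →ₗ[k] PSeries σ k) with hA
  have h : diffOp b (UniversalEnvelopingAlgebra.ι k x * u - u * UniversalEnvelopingAlgebra.ι k x) =
      diffOp b u * A - A * diffOp b u := by
    have := (commute_diffOp b x u).eq
    rw [add_mul, mul_add] at this
    rw [map_sub, map_mul, map_mul, sub_eq_sub_iff_add_eq_add, add_comm, this, add_comm]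
  have hA' : ∀ v, A.rTensor g v = act g (adField b x) v := fun _ => rfl
  rw [proj, h, LinearMap.rTensor_sub, LinearMap.rTensor_mul, LinearMap.rTensor_mul,
    LinearMap.sub_apply, Module.End.mul_apply, Module.End.mul_apply, hA', hA', map_sub]
  rw [adField, coeffs_zero_act b _ _ (by rw [coeffs_zero_lie, coeffs_zero_gen, lie_zero]),
    act_der_gen, rTensor_lie, coeffs_zero_lie, sub_zero, proj]

end FormalVectorField

open UniversalEnvelopingAlgebra in
/-- If a derivation `D : g → g` becomes inner when viewed as a derivation into `U(g)`
(via `ι`), then `D` is already an inner derivation of `g`.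
(Injectivity of `Out(g) → Out(g, U(g))`.) -/
theorem inner_of_inner_in_ue {k : Type*} [Field k] [CharZero k]
    {g : Type*} [LieRing g] [LieAlgebra k g] [FiniteDimensional k g]
    (D : g →ₗ[k] g)
    (hder : ∀ x y : g, D ⁅x, y⁆ = ⁅D x, y⁆ + ⁅x, D y⁆)
    (hinner : ∃ m : UniversalEnvelopingAlgebra k g,
      ∀ x : g, ι k (D x) = ι k x * m - m * ι k x) :
    ∃ y : g, ∀ x : g, D x = ⁅x, y⁆ := by
  obtain ⟨m, hm⟩ := hinner
  let b := Module.finBasis k g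
  refine ⟨FormalVectorField.proj b m, fun x => ?_⟩
  rw [← FormalVectorField.proj_commutator, ← hm, FormalVectorField.proj_ι]
end

section
/- There exists a finite-dimensional complex Lie algebra g and a derivation D : g → U(g) with respect to the adjoint action of g on U(g) that is almost inner but not inner. (Equivalently, Sha(g, U(g)) ≠ 0 for some finite-dimensional complex Lie algebra g.) -/
section

open UniversalEnvelopingAlgebra

attribute [local instance] LieRing.ofAssociativeRing

/-- The Heisenberg Lie algebra over the dual numbers `ℂ[ε]`, seen as a complex Lie algebra:
strictly upper triangular `3 × 3` matrices with entries in `ℂ[ε]`. -/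
def dualHeisenberg : LieSubalgebra ℂ (Matrix (Fin 3) (Fin 3) (DualNumber ℂ)) where
  carrier := {M | ∀ i j, j ≤ i → M i j = 0}
  add_mem' := by
    intro a b ha hb i j h
    simp [ha i j h, hb i j h]
  zero_mem' := by
    intro i j h
    rfl
  smul_mem' := by
    intro c a ha i j h
    simp [ha i j h]
  lie_mem' := by
    intro a b ha hb i j h
    simp only [Set.mem_ofPred_eq] at ha hb
    rw [LieRing.of_associative_ring_bracket]
    fin_cases i <;> fin_cases j <;>
      simp_all [Matrix.mul_apply, Fin.sum_univ_three]

namespace dualHeisenberg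

/-- The strictly upper triangular matrix with entries `p`, `q` above the diagonal and `z` in the
corner. -/
def mk (p q z : DualNumber ℂ) : dualHeisenberg :=
  ⟨!![0, p, z; 0, 0, q; 0, 0, 0], by
    intro i j h
    fin_cases i <;> fin_cases j <;> simp_all⟩

theorem exists_eq_mk (x : dualHeisenberg) : ∃ p q z, x = mk p q z := by
  refine ⟨x.1 0 1, x.1 1 2, x.1 0 2, Subtype.ext ?_⟩
  ext1 i j
  have := x.2 i j
  fin_cases i <;> fin_cases j <;> simp_all [mk]

theorem lie_mk (p q z p' q' z' : DualNumber ℂ) :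
    ⁅mk p q z, mk p' q' z'⁆ = mk 0 0 (p * q' - p' * q) := by
  apply Subtype.ext
  rw [LieSubalgebra.coe_bracket, LieRing.of_associative_ring_bracket]
  ext1 i j
  fin_cases i <;> fin_cases j <;> simp [mk]

theorem smul_mk (c : ℂ) (p q z : DualNumber ℂ) : c • mk p q z = mk (c • p) (c • q) (c • z) := by
  apply Subtype.ext
  ext1 i j
  fin_cases i <;> fin_cases j <;> simp [mk]

instance : FiniteDimensional ℂ dualHeisenberg :=
  haveI : Module.Finite ℂ (DualNumber ℂ) := inferInstanceAs (Module.Finite ℂ (ℂ × ℂ))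
  inferInstanceAs (FiniteDimensional ℂ dualHeisenberg.toSubmodule)

/-- The linear form reading the `ε`-coefficient of the `(0, 1)` entry. -/
def epsCoeff : dualHeisenberg →ₗ[ℂ] ℂ where
  toFun x := (x.1 0 1).snd
  map_add' _ _ := by simp
  map_smul' _ _ := by simp

theorem epsCoeff_mk (p q z : DualNumber ℂ) : epsCoeff (mk p q z) = p.snd :=
  rfl

theorem epsCoeff_lie (x y : dualHeisenberg) : epsCoeff ⁅x, y⁆ = 0 := by
  obtain ⟨p, q, z, rfl⟩ := exists_eq_mk x
  obtain ⟨p', q', z', rfl⟩ := exists_eq_mk y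
  simp [lie_mk, epsCoeff_mk]

theorem lie_mk_zero_zero (x : dualHeisenberg) (z : DualNumber ℂ) : ⁅x, mk 0 0 z⁆ = 0 := by
  obtain ⟨p, q, w, rfl⟩ := exists_eq_mk x
  rw [lie_mk]
  simpa using (smul_mk 0 0 0 0).symm

theorem exists_lie_eq (x : dualHeisenberg) :
    ∃ y, ⁅x, y⁆ = epsCoeff x • mk 0 0 DualNumber.eps := by
  obtain ⟨p, q, z, rfl⟩ := exists_eq_mk x
  simp only [epsCoeff_mk, smul_mk]
  by_cases hp : p.fst = 0
  · by_cases hq : q.fst = 0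
    · refine ⟨mk 0 1 0, ?_⟩
      rw [lie_mk]
      congr 1
      · simp
      · simp
      · ext <;> simp [hp]
    · refine ⟨mk (-(p.snd / q.fst) • DualNumber.eps) 0 0, ?_⟩
      rw [lie_mk]
      congr 1
      · simp
      · simp
      · ext <;> simp [hq]
  · refine ⟨mk 0 ((p.snd / p.fst) • DualNumber.eps) 0, ?_⟩
    rw [lie_mk]
    congr 1
    · simp
    · simp
    · ext <;> simp
      field_simp

end dualHeisenberg

theorem ι_lie_eq_mul_sub_mul {g : Type*} [LieRing g] [LieAlgebra ℂ g] (x y : g) :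
    ι ℂ ⁅x, y⁆ = ι ℂ x * ι ℂ y - ι ℂ y * ι ℂ x := by
  rw [LieHom.map_lie, LieRing.of_associative_ring_bracket]

open dualHeisenberg in
theorem not_exists_smul_eq_mul_sub_mul :
    ¬ ∃ m : UniversalEnvelopingAlgebra ℂ dualHeisenberg, ∀ x : dualHeisenberg,
      epsCoeff x • ι ℂ (mk 0 0 DualNumber.eps) = ι ℂ x * m - m * ι ℂ x := by
  rintro ⟨m, hm⟩
  have key (x : dualHeisenberg) :
      epsCoeff x • (mk 0 0 DualNumber.eps).1 =
        x.1 * lift ℂ dualHeisenberg.incl m - lift ℂ dualHeisenberg.incl m * x.1 := by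
    have := congrArg (lift ℂ dualHeisenberg.incl) (hm x)
    rwa [map_smul, map_sub, map_mul, map_mul, lift_ι_apply, lift_ι_apply] at this
  have h₁ := key (mk 1 0 0)
  have h₂ := key (mk DualNumber.eps 0 0)
  -- Commutators in the matrix algebra are `ℂ[ε]`-linear.
  have hsmul : (mk DualNumber.eps 0 0).1 = (DualNumber.eps : DualNumber ℂ) • (mk 1 0 0).1 := by
    ext1 i j
    fin_cases i <;> fin_cases j <;> simp [mk]
  rw [hsmul, smul_mul_assoc, mul_smul_comm, ← smul_sub, ← h₁, epsCoeff_mk, epsCoeff_mk] at h₂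
  have := congrArg TrivSqZeroExt.snd (congrFun (congrFun h₂ 0) 2)
  simp [mk] at this

end

open UniversalEnvelopingAlgebra in
/-- There exists a finite-dimensional complex Lie algebra `g` and a derivation
`D : g → U(g)` (for the adjoint action of `g` on `U(g)`) that is almost inner
but not inner; i.e. `Sha(g, U(g)) ≠ 0` for some finite-dimensional complex `g`. -/
theorem exists_sha_ue_ne_zero :
    ∃ (g : Type) (_ : LieRing g) (_ : LieAlgebra ℂ g) (_ : FiniteDimensional ℂ g)
      (D : g →ₗ[ℂ] UniversalEnvelopingAlgebra ℂ g),
      (∀ x y : g, D ⁅x, y⁆ =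
        (ι ℂ x * D y - D y * ι ℂ x) - (ι ℂ y * D x - D x * ι ℂ y)) ∧
      (∀ x : g, ∃ m : UniversalEnvelopingAlgebra ℂ g, D x = ι ℂ x * m - m * ι ℂ x) ∧
      ¬ ∃ m : UniversalEnvelopingAlgebra ℂ g, ∀ x : g, D x = ι ℂ x * m - m * ι ℂ x := by
  open dualHeisenberg in
  refine ⟨dualHeisenberg, inferInstance, inferInstance, inferInstance,
    epsCoeff.smulRight (ι ℂ (mk 0 0 DualNumber.eps)), ?_, ?_, ?_⟩
  · intro x y
    have central (x : dualHeisenberg) (c : ℂ) :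
        ι ℂ x * (c • ι ℂ (mk 0 0 DualNumber.eps)) -
          (c • ι ℂ (mk 0 0 DualNumber.eps)) * ι ℂ x = 0 := by
      rw [mul_smul_comm, smul_mul_assoc, ← smul_sub, ← ι_lie_eq_mul_sub_mul, lie_mk_zero_zero,
        map_zero, smul_zero]
    simp only [LinearMap.smulRight_apply, epsCoeff_lie, zero_smul, central, sub_self]
  · intro x
    obtain ⟨y, hy⟩ := exists_lie_eq x
    exact ⟨ι ℂ y, by rw [← ι_lie_eq_mul_sub_mul, hy, map_smul, LinearMap.smulRight_apply]⟩
  · exact not_exists_smul_eq_mul_sub_mul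
end

section
/- Let A be an associative unital algebra over a field k. If D and D' are almost inner derivations of A, then the commutator [D, D'] = D∘D' − D'∘D is an almost inner derivation of A. More precisely, if D(a) = am − ma and D'(a) = am' − m'a, then [D, D'](a) = an − na with n = mm' − m'm − D'(m) + D(m'). -/
/-- If `D` and `D'` are almost inner derivations of an associative unital `k`-algebra `A`,
then the commutator `[D, D'] = D ∘ D' - D' ∘ D` is an almost inner derivation.
More precisely, if `D a = a*m - m*a` and `D' a = a*m' - m'*a`, then
`[D, D'] a = a*n - n*a` where `n = m*m' - m'*m - D' m + D m'`. -/
theorem aid_bracket_closed {k A : Type*} [Field k] [Ring A] [Algebra k A]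
    (D D' : A →ₗ[k] A)
    (hD : ∀ a b : A, D (a * b) = D a * b + a * D b)
    (hD' : ∀ a b : A, D' (a * b) = D' a * b + a * D' b)
    (hDai : ∀ a : A, ∃ m : A, D a = a * m - m * a)
    (hD'ai : ∀ a : A, ∃ m : A, D' a = a * m - m * a) :
    (∀ a : A, ∃ n : A, D (D' a) - D' (D a) = a * n - n * a) ∧
    (∀ (a m m' : A), D a = a * m - m * a → D' a = a * m' - m' * a →
      D (D' a) - D' (D a) =
        a * (m * m' - m' * m - D' m + D m') - (m * m' - m' * m - D' m + D m') * a) := by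
  have key : ∀ a m m' : A, D a = a * m - m * a → D' a = a * m' - m' * a →
      D (D' a) - D' (D a) =
        a * (m * m' - m' * m - D' m + D m') - (m * m' - m' * m - D' m + D m') * a := by
    intro a m m' h h'
    have h₁ : D (D' a) = D a * m' + a * D m' - (D m' * a + m' * D a) := by
      rw [h', map_sub, hD, hD]
    have h₂ : D' (D a) = D' a * m + a * D' m - (D' m * a + m * D' a) := by
      rw [h, map_sub, hD', hD']
    rw [h₁, h₂, h, h']
    noncomm_ring
  refine ⟨fun a => ?_, key⟩
  obtain ⟨m, h⟩ := hDai a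
  obtain ⟨m', h'⟩ := hD'ai a
  exact ⟨_, key a m m' h h'⟩
end

section
/- Let k be a field of characteristic zero and g a Lie algebra over k. Every derivation D : g → U(g) with respect to the adjoint action of g on U(g) extends uniquely to an associative derivation of U(g): there exists a unique k-linear map D' : U(g) → U(g) satisfying D'(ab) = D'(a)b + aD'(b) for all a, b ∈ U(g) and D'(ι(x)) = D(x) for all x ∈ g. -/
section

open TrivSqZeroExt

/-- The algebra homomorphism `a ↦ a + ε D a` to the dual numbers attached to a linear map
satisfying the Leibniz rule. -/
def dualNumberHomOfLeibniz {R A : Type*} [CommRing R] [Ring A] [Algebra R A] (D : A →ₗ[R] A)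
    (hD : ∀ a b, D (a * b) = D a * b + a * D b) : A →ₐ[R] DualNumber A :=
  AlgHom.ofLinearMap
    { toFun := fun a => inl a + inr (D a)
      map_add' := fun a b => by ext <;> simp
      map_smul' := fun r a => by ext <;> simp }
    (by
      have h : D 1 = 0 := by simpa using hD 1 1
      ext <;> simp [h])
    (fun a b => by ext <;> simp [hD, add_comm])

attribute [local instance] LieRing.ofAssociativeRing

namespace UniversalEnvelopingAlgebra

variable {R L : Type*} [CommRing R] [LieRing L] [LieAlgebra R L]

/-- Two linear maps satisfying the Leibniz rule agree as soon as they agree on generators. -/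
theorem linearMap_ext_of_leibniz
    {D₁ D₂ : UniversalEnvelopingAlgebra R L →ₗ[R] UniversalEnvelopingAlgebra R L}
    (h₁ : ∀ a b, D₁ (a * b) = D₁ a * b + a * D₁ b)
    (h₂ : ∀ a b, D₂ (a * b) = D₂ a * b + a * D₂ b)
    (h : ∀ x, D₁ (ι R x) = D₂ (ι R x)) : D₁ = D₂ := by
  have key : dualNumberHomOfLeibniz D₁ h₁ = dualNumberHomOfLeibniz D₂ h₂ := by
    apply hom_ext
    apply LieHom.ext
    intro x
    change (inl (ι R x) + inr (D₁ (ι R x)) : DualNumber _) = inl (ι R x) + inr (D₂ (ι R x))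
    rw [h]
  ext1 a
  simpa [dualNumberHomOfLeibniz] using congrArg snd (DFunLike.congr_fun key a)

/-- The Lie homomorphism `x ↦ ι x + ε D x` to the dual numbers attached to a derivation `D` for
the adjoint action. -/
def dualNumberLieHom (D : L →ₗ[R] UniversalEnvelopingAlgebra R L)
    (hD : ∀ x y : L, D ⁅x, y⁆ =
      (ι R x * D y - D y * ι R x) - (ι R y * D x - D x * ι R y)) :
    L →ₗ⁅R⁆ DualNumber (UniversalEnvelopingAlgebra R L) where
  toFun x := inl (ι R x) + inr (D x)
  map_add' x y := by
    simp only [map_add, inl_add, inr_add]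
    abel
  map_smul' r x := by
    simp only [map_smul, inl_smul, inr_smul, smul_add, RingHom.id_apply]
  map_lie' {x y} := by
    rw [LieRing.of_associative_ring_bracket, LieHom.map_lie, LieRing.of_associative_ring_bracket,
      hD]
    ext
    · simp
    · simp only [snd_add, snd_sub, snd_mul, fst_add, fst_inl, fst_inr, snd_inl, snd_inr, add_zero,
        zero_add, smul_eq_mul, MulOpposite.smul_eq_mul_unop, MulOpposite.unop_op]
      abel

theorem fst_lift_dualNumberLieHom (D : L →ₗ[R] UniversalEnvelopingAlgebra R L)
    (hD : ∀ x y : L, D ⁅x, y⁆ =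
      (ι R x * D y - D y * ι R x) - (ι R y * D x - D x * ι R y))
    (a : UniversalEnvelopingAlgebra R L) : (lift R (dualNumberLieHom D hD) a).fst = a := by
  have h : (fstHom R _ _).comp (lift R (dualNumberLieHom D hD)) = AlgHom.id R _ := by
    apply hom_ext
    apply LieHom.ext
    intro x
    change (lift R (dualNumberLieHom D hD) (ι R x)).fst = ι R x
    rw [lift_ι_apply]
    exact add_zero _
  exact DFunLike.congr_fun h a

/-- The extension to the universal enveloping algebra of a derivation for the adjoint action. -/
def extendDerivation (D : L →ₗ[R] UniversalEnvelopingAlgebra R L)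
    (hD : ∀ x y : L, D ⁅x, y⁆ =
      (ι R x * D y - D y * ι R x) - (ι R y * D x - D x * ι R y)) :
    UniversalEnvelopingAlgebra R L →ₗ[R] UniversalEnvelopingAlgebra R L :=
  (sndHom _ _).restrictScalars R ∘ₗ (lift R (dualNumberLieHom D hD)).toLinearMap

theorem extendDerivation_ι (D : L →ₗ[R] UniversalEnvelopingAlgebra R L)
    (hD : ∀ x y : L, D ⁅x, y⁆ =
      (ι R x * D y - D y * ι R x) - (ι R y * D x - D x * ι R y)) (x : L) :
    extendDerivation D hD (ι R x) = D x := by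
  change (lift R (dualNumberLieHom D hD) (ι R x)).snd = D x
  rw [lift_ι_apply]
  exact zero_add _

theorem extendDerivation_mul (D : L →ₗ[R] UniversalEnvelopingAlgebra R L)
    (hD : ∀ x y : L, D ⁅x, y⁆ =
      (ι R x * D y - D y * ι R x) - (ι R y * D x - D x * ι R y))
    (a b : UniversalEnvelopingAlgebra R L) :
    extendDerivation D hD (a * b) =
      extendDerivation D hD a * b + a * extendDerivation D hD b := by
  change (lift R (dualNumberLieHom D hD) (a * b)).snd = _
  rw [map_mul, snd_mul, fst_lift_dualNumberLieHom, fst_lift_dualNumberLieHom, add_comm]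
  rfl

end UniversalEnvelopingAlgebra

end

open UniversalEnvelopingAlgebra in
/-- Every derivation `D : g → U(g)` (with respect to the adjoint action of `g` on `U(g)`)
extends uniquely to an associative derivation `D' : U(g) → U(g)` with `D' ∘ ι = D`. -/
theorem derivation_extends_uniquely {k : Type*} [Field k] [CharZero k]
    {g : Type*} [LieRing g] [LieAlgebra k g]
    (D : g →ₗ[k] UniversalEnvelopingAlgebra k g)
    (hder : ∀ x y : g, D ⁅x, y⁆ =
      (ι k x * D y - D y * ι k x) - (ι k y * D x - D x * ι k y)) :
    ∃! D' : UniversalEnvelopingAlgebra k g →ₗ[k] UniversalEnvelopingAlgebra k g,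
      (∀ a b : UniversalEnvelopingAlgebra k g, D' (a * b) = D' a * b + a * D' b) ∧
      (∀ x : g, D' (ι k x) = D x) := by
  exact ⟨extendDerivation D hder, ⟨extendDerivation_mul D hder, extendDerivation_ι D hder⟩,
    fun D' hD' => linearMap_ext_of_leibniz hD'.1 (extendDerivation_mul D hder) fun x =>
      (hD'.2 x).trans (extendDerivation_ι D hder x).symm⟩
end

section
/- There exists an associative unital ℂ-algebra A that is finitely generated as a ℂ-algebra and admits a derivation that is almost inner but not inner. (Equivalently, Sha_a(A) ≠ 0 for some finitely generated associative algebra A.) -/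
open DualNumber in
/-- The upper triangular `3 × 3` matrices over the dual numbers `ℂ[ε]` whose diagonal is a
constant complex scalar. -/
def heisenbergSubalgebra : Subalgebra ℂ (Matrix (Fin 3) (Fin 3) ℂ[ε]) where
  carrier := {M | ∃ (c : ℂ) (a b z : ℂ[ε]),
    M = !![algebraMap ℂ ℂ[ε] c, a, z; 0, algebraMap ℂ ℂ[ε] c, b; 0, 0, algebraMap ℂ ℂ[ε] c]}
  mul_mem' := by
    rintro _ _ ⟨c, a, b, z, rfl⟩ ⟨c', a', b', z', rfl⟩
    refine ⟨c * c', algebraMap ℂ ℂ[ε] c * a' + a * algebraMap ℂ ℂ[ε] c',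
      algebraMap ℂ ℂ[ε] c * b' + b * algebraMap ℂ ℂ[ε] c',
      algebraMap ℂ ℂ[ε] c * z' + a * b' + z * algebraMap ℂ ℂ[ε] c', ?_⟩
    ext1 i j
    fin_cases i <;> fin_cases j <;> simp [Matrix.mul_apply, Fin.sum_univ_three]
  add_mem' := by
    rintro _ _ ⟨c, a, b, z, rfl⟩ ⟨c', a', b', z', rfl⟩
    refine ⟨c + c', a + a', b + b', z + z', ?_⟩
    ext1 i j
    fin_cases i <;> fin_cases j <;> simp
  algebraMap_mem' r := by
    refine ⟨r, 0, 0, 0, ?_⟩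
    ext1 i j
    fin_cases i <;> fin_cases j <;> simp [Matrix.algebraMap_matrix_apply]

open DualNumber in
theorem DualNumber.fst_algebraMap_complex (c : ℂ) : (algebraMap ℂ ℂ[ε] c).fst = c := rfl

open DualNumber in
/-- The linear map sending a matrix to the constant part of its `(0, 1)` entry, placed in
position `(0, 2)`. -/
def cornerConstantPart : Matrix (Fin 3) (Fin 3) ℂ[ε] →ₗ[ℂ] Matrix (Fin 3) (Fin 3) ℂ[ε] where
  toFun M := !![0, 0, algebraMap ℂ ℂ[ε] (M 0 1).fst; 0, 0, 0; 0, 0, 0]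
  map_add' M N := by
    ext1 i j
    fin_cases i <;> fin_cases j <;> simp
  map_smul' r M := by
    ext1 i j
    fin_cases i <;> fin_cases j <;> simp [Algebra.smul_def, DualNumber.fst_algebraMap_complex]

open DualNumber in
theorem cornerConstantPart_mem (M : Matrix (Fin 3) (Fin 3) ℂ[ε]) :
    cornerConstantPart M ∈ heisenbergSubalgebra :=
  ⟨0, 0, 0, algebraMap ℂ ℂ[ε] (M 0 1).fst, by simp [cornerConstantPart]⟩

open DualNumber in
theorem cornerConstantPart_mul {M N : Matrix (Fin 3) (Fin 3) ℂ[ε]}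
    (hM : M ∈ heisenbergSubalgebra) (hN : N ∈ heisenbergSubalgebra) :
    cornerConstantPart (M * N) = cornerConstantPart M * N + M * cornerConstantPart N := by
  obtain ⟨c, a, b, z, rfl⟩ := hM
  obtain ⟨c', a', b', z', rfl⟩ := hN
  ext1 i j
  fin_cases i <;> fin_cases j <;>
    simp [cornerConstantPart, DualNumber.fst_algebraMap_complex]
  simp only [Algebra.smul_def]
  ring

open DualNumber in
theorem exists_cornerConstantPart_eq_commutator {M : Matrix (Fin 3) (Fin 3) ℂ[ε]}
    (hM : M ∈ heisenbergSubalgebra) :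
    ∃ N ∈ heisenbergSubalgebra, cornerConstantPart M = M * N - N * M := by
  obtain ⟨c, a, b, z, rfl⟩ := hM
  obtain ⟨b', hb'⟩ : ∃ b' : ℂ[ε], a * b' = algebraMap ℂ ℂ[ε] a.fst := by
    by_cases ha : a.fst = 0
    · exact ⟨0, by simp [ha]⟩
    · obtain ⟨u, hu⟩ := TrivSqZeroExt.isUnit_iff_isUnit_fst.2 (isUnit_iff_ne_zero.2 ha)
      exact ⟨↑u⁻¹ * algebraMap ℂ ℂ[ε] a.fst, by rw [← mul_assoc, ← hu, Units.mul_inv, one_mul]⟩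
  refine ⟨_, ⟨0, 0, b', 0, rfl⟩, ?_⟩
  ext1 i j
  fin_cases i <;> fin_cases j <;>
    simp [cornerConstantPart, hb']
  rw [Algebra.smul_def, mul_comm, sub_self]

open DualNumber in
theorem not_exists_cornerConstantPart_eq_commutator :
    ¬ ∃ N ∈ heisenbergSubalgebra, ∀ M ∈ heisenbergSubalgebra,
      cornerConstantPart M = M * N - N * M := by
  rintro ⟨_, ⟨c, a, b, z, rfl⟩, h⟩
  have h_one := congr_fun₂ (h _ ⟨0, 1, 0, 0, rfl⟩) 0 2
  have h_eps := congr_fun₂ (h _ ⟨0, ε, 0, 0, rfl⟩) 0 2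
  simp [cornerConstantPart] at h_one h_eps
  rw [← h_one, mul_one] at h_eps
  simpa using congrArg TrivSqZeroExt.snd h_eps

/-- There exists a finitely generated associative unital `ℂ`-algebra `A` admitting a
derivation that is almost inner but not inner; i.e. `Sha_a(A) ≠ 0` for some finitely
generated `A`. -/
theorem exists_fg_algebra_sha_a_ne_zero :
    ∃ (A : Type) (_ : Ring A) (_ : Algebra ℂ A),
      Algebra.FiniteType ℂ A ∧
      ∃ D : A →ₗ[ℂ] A,
        (∀ a b : A, D (a * b) = D a * b + a * D b) ∧
        (∀ a : A, ∃ m : A, D a = a * m - m * a) ∧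
        ¬ ∃ m : A, ∀ a : A, D a = a * m - m * a := by
  have : Module.Finite ℂ (DualNumber ℂ) := inferInstanceAs (Module.Finite ℂ (ℂ × ℂ))
  have : Module.Finite ℂ heisenbergSubalgebra :=
    inferInstanceAs (Module.Finite ℂ (Subalgebra.toSubmodule heisenbergSubalgebra))
  refine ⟨heisenbergSubalgebra, inferInstance, inferInstance, inferInstance,
    (cornerConstantPart.comp heisenbergSubalgebra.val.toLinearMap).codRestrict
      (Subalgebra.toSubmodule heisenbergSubalgebra) fun M ↦ cornerConstantPart_mem M,
    fun a b ↦ Subtype.ext (cornerConstantPart_mul a.2 b.2), fun a ↦ ?_, ?_⟩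
  · obtain ⟨m, hm, h⟩ := exists_cornerConstantPart_eq_commutator a.2
    exact ⟨⟨m, hm⟩, Subtype.ext h⟩
  · rintro ⟨m, h⟩
    exact not_exists_cornerConstantPart_eq_commutator
      ⟨m, m.2, fun M hM ↦ congrArg Subtype.val (h ⟨M, hM⟩)⟩
end

section
/- Let k be a field of characteristic zero and A an associative unital k-algebra with dim_k A ≤ 4. Then every almost inner derivation of A is inner, i.e. Sha_a(A) = 0. -/
section AlmostInner

variable {k L : Type*} [Field k] [LieRing L] [LieAlgebra k L]

/-- `x`, `y`, `z` span the Lie algebra `L` modulo its center. -/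
def SpansModCenter (k : Type*) {L : Type*} [Field k] [LieRing L] [LieAlgebra k L]
    (x y z : L) : Prop :=
  ∀ v : L, ∃ a b c : k, v - (a • x + b • y + c • z) ∈ LieAlgebra.center k L

theorem SpansModCenter.rotate {x y z : L} (h : SpansModCenter k x y z) :
    SpansModCenter k y z x := fun v => by
  obtain ⟨a, b, c, hv⟩ := h v
  exact ⟨b, c, a, by convert hv using 2; abel⟩

theorem SpansModCenter.swap {x y z : L} (h : SpansModCenter k x y z) :
    SpansModCenter k y x z := fun v => by
  obtain ⟨a, b, c, hv⟩ := h v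
  exact ⟨b, a, c, by convert hv using 2; abel⟩

theorem lie_eq_zero_of_mem_center {c : L} (hc : c ∈ LieAlgebra.center k L) (v : L) :
    ⁅c, v⁆ = 0 := by
  rw [← lie_skew, (LieModule.mem_maxTrivSubmodule k L L c).1 hc v, neg_zero]

theorem SpansModCenter.exists_lie_eq {x y z : L} (h : SpansModCenter k x y z) (m : L) :
    ∃ a b c : k, ∀ u : L, ⁅u, m⁆ = a • ⁅u, x⁆ + b • ⁅u, y⁆ + c • ⁅u, z⁆ := by
  obtain ⟨a, b, c, hv⟩ := h m
  refine ⟨a, b, c, fun u => ?_⟩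
  have := (LieModule.mem_maxTrivSubmodule k L L _).1 hv u
  simpa [sub_eq_zero] using this

theorem SpansModCenter.mem_center {x y z u : L} (h : SpansModCenter k x y z)
    (hx : ⁅u, x⁆ = 0) (hy : ⁅u, y⁆ = 0) (hz : ⁅u, z⁆ = 0) : u ∈ LieAlgebra.center k L := by
  refine (LieModule.mem_maxTrivSubmodule k L L u).2 fun m => ?_
  obtain ⟨a, b, c, hm⟩ := h.exists_lie_eq m
  rw [← lie_skew, hm u, hx, hy, hz]
  simp

variable {D : L →ₗ[k] L} {x y z : L}

/-- An almost inner map is inner as soon as it agrees with an inner one on elements spanning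
modulo the center. -/
theorem SpansModCenter.eq_lie (h : SpansModCenter k x y z)
    (hD : ∀ a, ∃ m, D a = ⁅a, m⁆) {m : L} (hx : D x = ⁅x, m⁆) (hy : D y = ⁅y, m⁆)
    (hz : D z = ⁅z, m⁆) (v : L) : D v = ⁅v, m⁆ := by
  obtain ⟨a, b, c, hv⟩ := h v
  obtain ⟨n, hn⟩ := hD (v - (a • x + b • y + c • z))
  rw [lie_eq_zero_of_mem_center hv] at hn
  have h0 := lie_eq_zero_of_mem_center hv m
  simp only [map_sub, map_add, map_smul, sub_lie, add_lie, smul_lie, sub_eq_zero, hx, hy, hz]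
    at hn h0
  rw [hn, h0]

theorem SpansModCenter.exists_inner_of_mem_center (h : SpansModCenter k x y z)
    (hD : ∀ a, ∃ m, D a = ⁅a, m⁆) (hx : x ∈ LieAlgebra.center k L) :
    ∃ m, ∀ a, D a = ⁅a, m⁆ := by
  have hxl := lie_eq_zero_of_mem_center hx
  have hxr := (LieModule.mem_maxTrivSubmodule k L L x).1 hx
  obtain ⟨m₁, h₁⟩ := hD y
  obtain ⟨m₂, h₂⟩ := hD z
  obtain ⟨m₀, h₀⟩ := hD x
  obtain ⟨a₁, b₁, c₁, e₁⟩ := h.exists_lie_eq m₁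
  obtain ⟨a₂, b₂, c₂, e₂⟩ := h.exists_lie_eq m₂
  refine ⟨b₂ • y + c₁ • z, h.eq_lie hD ?_ ?_ ?_⟩
  · rw [h₀, hxl, hxl]
  · simp [h₁, e₁, hxr]
  · simp [h₂, e₂, hxr]

/-- If a combination of `x` and `y` with nonzero first coefficient is central, the problem
reduces to two generators. -/
theorem SpansModCenter.exists_inner_of_smul_add_smul_mem_center (h : SpansModCenter k x y z)
    (hD : ∀ a, ∃ m, D a = ⁅a, m⁆) {s t : k} (hs : s ≠ 0)
    (hc : s • x + t • y ∈ LieAlgebra.center k L) : ∃ m, ∀ a, D a = ⁅a, m⁆ := by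
  refine SpansModCenter.exists_inner_of_mem_center (x := s • x + t • y) (y := y) (z := z)
    (fun v => ?_) hD hc
  obtain ⟨a, b, c, hv⟩ := h v
  refine ⟨a / s, b - a * t / s, c, ?_⟩
  convert hv using 2
  match_scalars <;> field_simp
  ring

theorem SpansModCenter.exists_inner_of_lie_eq_zero (h : SpansModCenter k x y z)
    (hD : ∀ a, ∃ m, D a = ⁅a, m⁆) (hxy : ⁅x, y⁆ = 0) : ∃ m, ∀ a, D a = ⁅a, m⁆ := by
  have hyx : ⁅y, x⁆ = 0 := by rw [← lie_skew, hxy, neg_zero]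
  by_cases hli : LinearIndependent k ![⁅x, z⁆, ⁅y, z⁆]
  · rw [LinearIndependent.pair_iff] at hli
    obtain ⟨m₁, h₁⟩ := hD x
    obtain ⟨m₂, h₂⟩ := hD y
    obtain ⟨m₃, h₃⟩ := hD z
    obtain ⟨m₄, h₄⟩ := hD (x + y)
    obtain ⟨a₁, b₁, c₁, e₁⟩ := h.exists_lie_eq m₁
    obtain ⟨a₂, b₂, c₂, e₂⟩ := h.exists_lie_eq m₂
    obtain ⟨a₃, b₃, c₃, e₃⟩ := h.exists_lie_eq m₃
    obtain ⟨a₄, b₄, c₄, e₄⟩ := h.exists_lie_eq m₄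
    rw [map_add, h₁, h₂, e₁, e₂, e₄] at h₄
    simp only [add_lie, lie_self, hxy, hyx, smul_zero, add_zero, zero_add] at h₄
    obtain ⟨h14, h24⟩ := hli (c₁ - c₄) (c₂ - c₄) (by
      rw [← sub_eq_zero] at h₄
      rw [← h₄]
      module)
    have hc : c₂ = c₁ := by linear_combination h24 - h14
    refine ⟨a₃ • x + b₃ • y + c₁ • z, h.eq_lie hD ?_ ?_ ?_⟩
    · simp [h₁, e₁, hxy]
    · simp [h₂, e₂, hyx, hc]
    · simp [h₃, e₃]
  · simp only [LinearIndependent.pair_iff, not_forall] at hli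
    obtain ⟨s, t, hst, hne⟩ := hli
    have hc : s • x + t • y ∈ LieAlgebra.center k L :=
      h.mem_center (by simp [hyx]) (by simp [hxy]) (by simpa using hst)
    by_cases hs : s = 0
    · have ht : t ≠ 0 := fun ht => hne ⟨hs, ht⟩
      exact h.swap.exists_inner_of_smul_add_smul_mem_center hD ht (add_comm (s • x) _ ▸ hc)
    · exact h.exists_inner_of_smul_add_smul_mem_center hD hs hc

/-- A linear relation between the brackets of the generators comes from a pair of commuting
elements, since every bivector in dimension three is decomposable. -/
theorem SpansModCenter.exists_inner_of_relation (h : SpansModCenter k x y z)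
    (hD : ∀ a, ∃ m, D a = ⁅a, m⁆) {a b c : k} (ha : a ≠ 0)
    (hrel : a • ⁅y, z⁆ + b • ⁅z, x⁆ + c • ⁅x, y⁆ = 0) : ∃ m, ∀ a, D a = ⁅a, m⁆ := by
  refine SpansModCenter.exists_inner_of_lie_eq_zero (x := a • y - b • x) (y := a • z - c • x)
    (z := x) (fun v => ?_) hD ?_
  · obtain ⟨α, β, γ, hv⟩ := h v
    refine ⟨β / a, γ / a, α + β * b / a + γ * c / a, ?_⟩
    convert hv using 2
    match_scalars <;> field_simp
    ring
  · have : ⁅a • y - b • x, a • z - c • x⁆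
        = a • (a • ⁅y, z⁆ + b • ⁅z, x⁆ + c • ⁅x, y⁆) := by
      simp only [sub_lie, lie_sub, smul_lie, lie_smul, lie_self]
      rw [← lie_skew y x, ← lie_skew x z]
      module
    rw [this, hrel, smul_zero]

theorem SpansModCenter.exists_inner (h : SpansModCenter k x y z)
    (hD : ∀ a, ∃ m, D a = ⁅a, m⁆) : ∃ m, ∀ a, D a = ⁅a, m⁆ := by
  by_cases hli : ∀ a b c : k, a • ⁅y, z⁆ + b • ⁅z, x⁆ + c • ⁅x, y⁆ = 0 → a = 0 ∧ b = 0 ∧ c = 0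
  · obtain ⟨m₁, h₁⟩ := hD x
    obtain ⟨m₂, h₂⟩ := hD y
    obtain ⟨m₃, h₃⟩ := hD z
    obtain ⟨m₄, h₄⟩ := hD (x + y)
    obtain ⟨m₅, h₅⟩ := hD (y + z)
    obtain ⟨m₆, h₆⟩ := hD (z + x)
    obtain ⟨a₁, b₁, c₁, e₁⟩ := h.exists_lie_eq m₁
    obtain ⟨a₂, b₂, c₂, e₂⟩ := h.exists_lie_eq m₂
    obtain ⟨a₃, b₃, c₃, e₃⟩ := h.exists_lie_eq m₃
    obtain ⟨a₄, b₄, c₄, e₄⟩ := h.exists_lie_eq m₄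
    obtain ⟨a₅, b₅, c₅, e₅⟩ := h.exists_lie_eq m₅
    obtain ⟨a₆, b₆, c₆, e₆⟩ := h.exists_lie_eq m₆
    have hyx := (lie_skew y x).symm
    have hzy := (lie_skew z y).symm
    have hxz := (lie_skew x z).symm
    rw [map_add, h₁, h₂, e₁, e₂, e₄, ← sub_eq_zero] at h₄
    rw [map_add, h₂, h₃, e₂, e₃, e₅, ← sub_eq_zero] at h₅
    rw [map_add, h₃, h₁, e₃, e₁, e₆, ← sub_eq_zero] at h₆
    simp only [add_lie, lie_self, hyx, hzy, hxz] at h₄ h₅ h₆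
    obtain ⟨p₁, p₂, -⟩ := hli (c₂ - c₄) (c₄ - c₁) (b₁ - a₂ - b₄ + a₄) (by
      rw [← h₄]; module)
    obtain ⟨-, p₃, p₄⟩ := hli (c₂ - b₃ - c₅ + b₅) (a₃ - a₅) (a₅ - a₂) (by
      rw [← h₅]; module)
    obtain ⟨p₅, -, p₆⟩ := hli (b₆ - b₃) (a₃ - c₁ - a₆ + c₆) (b₁ - b₆) (by
      rw [← h₆]; module)
    have hc : c₂ = c₁ := by linear_combination p₁ + p₂
    have ha : a₃ = a₂ := by linear_combination p₃ + p₄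
    have hb : b₃ = b₁ := by linear_combination -p₅ - p₆
    refine ⟨a₂ • x + b₁ • y + c₁ • z, h.eq_lie hD ?_ ?_ ?_⟩
    · simp [h₁, e₁]
    · simp [h₂, e₂, hc]
    · simp [h₃, e₃, ha, hb]
  · simp only [not_forall] at hli
    obtain ⟨a, b, c, hrel, hne⟩ := hli
    by_cases ha : a = 0
    · by_cases hb : b = 0
      · have hc : c ≠ 0 := fun hc => hne ⟨ha, hb, hc⟩
        exact h.rotate.rotate.exists_inner_of_relation hD (a := c) (b := a) (c := b) hc
          (by rw [← hrel]; abel)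
      · exact h.rotate.exists_inner_of_relation hD (a := b) (b := c) (c := a) hb
          (by rw [← hrel]; abel)
    · exact h.exists_inner_of_relation hD ha hrel

theorem exists_span_triple_of_finrank_le_three {k V : Type*} [Field k] [AddCommGroup V]
    [Module k V] [FiniteDimensional k V] (h : Module.finrank k V ≤ 3) :
    ∃ x y z : V, ∀ v : V, ∃ a b c : k, v = a • x + b • y + c • z := by
  obtain ⟨g, hg⟩ : ∃ g : (Fin 3 → k) →ₗ[k] V, Function.Surjective g :=
    ⟨(Module.finBasis k V).equivFun.symm.toLinearMap ∘ₗ LinearMap.funLeft k k (Fin.castLE h),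
      (Module.finBasis k V).equivFun.symm.surjective.comp
        (LinearMap.funLeft_surjective_of_injective k k _ (Fin.castLE_injective h))⟩
  refine ⟨g (Pi.single 0 1), g (Pi.single 1 1), g (Pi.single 2 1), fun v => ?_⟩
  obtain ⟨w, rfl⟩ := hg v
  refine ⟨w 0, w 1, w 2, ?_⟩
  rw [← map_smul, ← map_smul, ← map_smul, ← map_add, ← map_add]
  refine congrArg g ?_
  ext i
  fin_cases i <;> simp

end AlmostInner

/-- If `A` is an associative unital algebra of dimension at most 4 over a field `k` of
characteristic zero, then every almost inner derivation of `A` is inner, i.e.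
`Sha_a(A) = 0`. -/
theorem sha_a_eq_zero_of_dim_le_four {k A : Type*} [Field k] [CharZero k]
    [Ring A] [Algebra k A] [FiniteDimensional k A]
    (hdim : Module.finrank k A ≤ 4)
    (D : A →ₗ[k] A)
    (hder : ∀ a b : A, D (a * b) = D a * b + a * D b)
    (hai : ∀ a : A, ∃ m : A, D a = a * m - m * a) :
    ∃ m : A, ∀ a : A, D a = a * m - m * a := by
  let _ : LieRing A := LieRing.ofAssociativeRing
  let _ : LieAlgebra k A := LieAlgebra.ofAssociativeAlgebra
  have key : ∃ x y z : A, SpansModCenter k x y z := by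
    rcases subsingleton_or_nontrivial A with hA | hA
    · exact ⟨0, 0, 0, fun v => ⟨0, 0, 0, by
        rw [Subsingleton.elim (v - _) 0]; exact zero_mem _⟩⟩
    have hone : (1 : A) ∈ LieAlgebra.center k A :=
      (LieModule.mem_maxTrivSubmodule k A A 1).2 fun v => by simp [Ring.lie_def]
    have hq : Module.finrank k (A ⧸ (k ∙ (1 : A))) ≤ 3 := by
      have := (k ∙ (1 : A)).finrank_quotient_add_finrank
      rw [finrank_span_singleton one_ne_zero] at this
      omega
    obtain ⟨x, y, z, hxyz⟩ := exists_span_triple_of_finrank_le_three hq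
    obtain ⟨x, rfl⟩ := Submodule.Quotient.mk_surjective _ x
    obtain ⟨y, rfl⟩ := Submodule.Quotient.mk_surjective _ y
    obtain ⟨z, rfl⟩ := Submodule.Quotient.mk_surjective _ z
    refine ⟨x, y, z, fun v => ?_⟩
    obtain ⟨a, b, c, hv⟩ := hxyz (Submodule.Quotient.mk v)
    refine ⟨a, b, c, ?_⟩
    rw [← Submodule.Quotient.mk_smul, ← Submodule.Quotient.mk_smul,
      ← Submodule.Quotient.mk_smul, ← Submodule.Quotient.mk_add,
      ← Submodule.Quotient.mk_add, Submodule.Quotient.eq] at hv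
    obtain ⟨t, ht⟩ := Submodule.mem_span_singleton.1 hv
    rw [← ht]
    exact SMulMemClass.smul_mem t hone
  obtain ⟨x, y, z, h⟩ := key
  exact h.exists_inner hai
end

section
/- Let g be a Lie algebra over a field k. If D and D' are almost inner derivations of g, then the commutator [D, D'] = D∘D' − D'∘D is an almost inner derivation of g; in particular, the almost inner derivations of g form a Lie subalgebra of the Lie algebra of all derivations of g. -/
/-- If `D` and `D'` are almost inner derivations of a Lie algebra `g` over a field `k`,
then their commutator `[D, D'] = D ∘ D' - D' ∘ D` is an almost inner derivation; in
particular the almost inner derivations form a Lie subalgebra of the derivations. -/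
theorem aid_lie_bracket_closed {k : Type*} [Field k]
    {g : Type*} [LieRing g] [LieAlgebra k g]
    (D D' : LieDerivation k g g)
    (hD : ∀ x : g, ∃ y : g, D x = ⁅x, y⁆)
    (hD' : ∀ x : g, ∃ y : g, D' x = ⁅x, y⁆) :
    ∀ x : g, ∃ y : g, D (D' x) - D' (D x) = ⁅x, y⁆ := by
  intro x
  obtain ⟨y, hy⟩ := hD x
  obtain ⟨z, hz⟩ := hD' x
  refine ⟨⁅y, z⁆ + D z - D' y, ?_⟩
  have h₁ : D (D' x) = ⁅x, D z⁆ + ⁅⁅x, y⁆, z⁆ := by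
    rw [hz, LieDerivation.apply_lie_eq_add, hy]
  have h₂ : D' (D x) = ⁅x, D' y⁆ + ⁅⁅x, z⁆, y⁆ := by
    rw [hy, LieDerivation.apply_lie_eq_add, hz]
  rw [h₁, h₂, lie_sub, lie_add, leibniz_lie x y z, ← lie_skew ⁅x, z⁆ y]
  abel
end

section
/- There exists an associative unital ℂ-algebra A and a ℂ-algebra automorphism φ of A such that φ is almost inner (for every x ∈ A there exists an invertible element a ∈ Aˣ with φ(x) = a x a⁻¹) but not inner (there is no single invertible element a ∈ Aˣ with φ(x) = a x a⁻¹ for all x ∈ A). (Equivalently, Sha_m(A) ≠ 1 for some associative unital algebra A.) -/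
section EventuallyScalar

open Filter

variable (k : Type*) (R : Type*) [CommRing k] [Ring R] [Algebra k R]

/-- The sequences in `R` all but finitely many of whose terms equal one scalar. -/
def eventuallyScalar : Subalgebra k (ℕ → R) where
  carrier := {f | ∃ c : k, ∀ᶠ n in atTop, f n = algebraMap k R c}
  mul_mem' := by
    rintro f g ⟨c, hc⟩ ⟨d, hd⟩
    refine ⟨c * d, ?_⟩
    filter_upwards [hc, hd] with n hn hn'
    simp [hn, hn']
  add_mem' := by
    rintro f g ⟨c, hc⟩ ⟨d, hd⟩
    refine ⟨c + d, ?_⟩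
    filter_upwards [hc, hd] with n hn hn'
    simp [hn, hn']
  algebraMap_mem' c := ⟨c, Eventually.of_forall fun _ => rfl⟩

variable {k R}

namespace eventuallyScalar

/-- Termwise conjugation by a unit, as an algebra homomorphism. -/
def conjHom (u : Rˣ) : eventuallyScalar k R →ₐ[k] eventuallyScalar k R where
  toFun f := ⟨fun n => u * f.1 n * ↑u⁻¹, by
    obtain ⟨c, hc⟩ := f.2
    refine ⟨c, hc.mono fun n hn => ?_⟩
    simp [hn, ← Algebra.commutes c (u : R), mul_assoc]⟩
  map_one' := by ext n; simp
  map_mul' f g := by ext n; simp [mul_assoc]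
  map_zero' := by ext n; simp
  map_add' f g := by ext n; simp [mul_add, add_mul]
  commutes' c := by
    ext n
    change (u : R) * algebraMap k R c * ↑u⁻¹ = algebraMap k R c
    simp [← Algebra.commutes c (u : R), mul_assoc]

@[simp]
theorem conjHom_apply (u : Rˣ) (f : eventuallyScalar k R) (n : ℕ) :
    (conjHom u f).1 n = u * f.1 n * ↑u⁻¹ := rfl

/-- Termwise conjugation by a unit, as an algebra automorphism. -/
def conj (u : Rˣ) : eventuallyScalar k R ≃ₐ[k] eventuallyScalar k R :=
  AlgEquiv.ofAlgHom (conjHom u) (conjHom u⁻¹)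
    (by ext f n; simp [mul_assoc]) (by ext f n; simp [mul_assoc])

@[simp]
theorem conj_apply (u : Rˣ) (f : eventuallyScalar k R) (n : ℕ) :
    (conj u f).1 n = u * f.1 n * ↑u⁻¹ := rfl

/-- The sequence equal to `u` before `N` and to `1` from `N` on. -/
def truncate (u : R) (N : ℕ) : eventuallyScalar k R :=
  ⟨fun n => if n < N then u else 1, 1, by
    filter_upwards [eventually_ge_atTop N] with n hn
    simp [hn.not_gt]⟩

theorem truncate_apply (u : R) (N n : ℕ) :
    (truncate u N : eventuallyScalar k R).1 n = if n < N then u else 1 := rfl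

/-- `truncate` of a unit is a unit. -/
def truncateUnit (u : Rˣ) (N : ℕ) : (eventuallyScalar k R)ˣ where
  val := truncate u N
  inv := truncate ↑u⁻¹ N
  val_inv := by
    ext n
    by_cases h : n < N <;> simp [truncate_apply, h]
  inv_val := by
    ext n
    by_cases h : n < N <;> simp [truncate_apply, h]

theorem exists_conj_eq (u : Rˣ) (f : eventuallyScalar k R) :
    ∃ a : (eventuallyScalar k R)ˣ, conj u f = ↑a * f * ↑a⁻¹ := by
  obtain ⟨c, hc⟩ := f.2
  obtain ⟨N, hN⟩ := eventually_atTop.1 hc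
  refine ⟨truncateUnit u N, ?_⟩
  ext n
  change (u : R) * f.1 n * ↑u⁻¹ =
    (if n < N then (u : R) else 1) * f.1 n * (if n < N then (↑u⁻¹ : R) else 1)
  by_cases h : n < N
  · simp [h]
  · simp [h, hN n (not_lt.1 h), ← Algebra.commutes c (u : R), mul_assoc]

/-- The sequence whose only possibly nonzero term is `r`, in position `m`. -/
def single (m : ℕ) (r : R) : eventuallyScalar k R :=
  ⟨Pi.single m r, 0, by
    filter_upwards [eventually_gt_atTop m] with n hn
    simp [hn.ne']⟩

theorem commute_of_conj_eq (u : Rˣ) (a : (eventuallyScalar k R)ˣ)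
    (h : ∀ f : eventuallyScalar k R, conj u f = ↑a * f * ↑a⁻¹) (r : R) : Commute (u : R) r := by
  obtain ⟨c, hc⟩ := a.1.2
  obtain ⟨m, hm⟩ := hc.exists
  have key : (u : R) * r * ↑u⁻¹ = a.1.1 m * r * (a⁻¹).1.1 m := by
    simpa [single] using congrFun (congrArg Subtype.val (h (single m r))) m
  have hinv : a.1.1 m * (a⁻¹).1.1 m = 1 :=
    congrFun (congrArg Subtype.val a.mul_inv) m
  rw [hm] at key hinv
  rw [Algebra.commutes, mul_assoc r, hinv, mul_one] at key
  exact (Units.mul_inv_eq_iff_eq_mul u).1 key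

end eventuallyScalar

end EventuallyScalar

/-- There exists an associative unital `ℂ`-algebra `A` and a `ℂ`-algebra automorphism of
`A` that is almost inner but not inner; i.e. `Sha_m(A) ≠ 1` for some `A`. -/
theorem exists_algebra_aiaut_not_inner :
    ∃ (A : Type) (_ : Ring A) (_ : Algebra ℂ A) (φ : A ≃ₐ[ℂ] A),
      (∀ x : A, ∃ a : Aˣ, φ x = ↑a * x * ↑a⁻¹) ∧
      ¬ ∃ a : Aˣ, ∀ x : A, φ x = ↑a * x * ↑a⁻¹ := by
  have hu : (!![0, 1; 1, 0] : Matrix (Fin 2) (Fin 2) ℂ) * !![0, 1; 1, 0] = 1 := by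
    simp [Matrix.one_fin_two]
  let u : (Matrix (Fin 2) (Fin 2) ℂ)ˣ := ⟨_, _, hu, hu⟩
  refine ⟨eventuallyScalar ℂ (Matrix (Fin 2) (Fin 2) ℂ), inferInstance, inferInstance,
    eventuallyScalar.conj u, eventuallyScalar.exists_conj_eq u, ?_⟩
  rintro ⟨a, ha⟩
  have h := congrFun₂ (eventuallyScalar.commute_of_conj_eq u a ha !![1, 0; 0, 0]).eq 0 1
  simp [u] at h
end
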